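/- Let ρ be a non-separable PPT state of rank 4 on ℂ^3 ⊗ ℂ^3. Then the rank of the partial transpose ρ^{T1} is also 4. -/

import Mathlib

open scoped ComplexConjugate ComplexOrder

/-- The standard Hermitian inner product, conjugate-linear in the first argument. -/
noncomputable def hinner {α : Type*} [Fintype α] (x y : α → ℂ) : ℂ :=
  ∑ a, conj (x a) * y a

/-- The product vector `φ ⊗ ψ` in `ℂ^n ⊗ ℂ^m`, identified with `Fin n × Fin m → ℂ`. -/
noncomputable def prodVec {n m : ℕ} (φ : Fin n → ℂ) (ψ : Fin m → ℂ) :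
    Fin n × Fin m → ℂ :=
  fun p => φ p.1 * ψ p.2

/-- The partial transpose with respect to the first subsystem:
`ρ^{T1}((i,j),(k,l)) = ρ((k,j),(i,l))`. -/
noncomputable def pt {n m : ℕ} (ρ : Matrix (Fin n × Fin m) (Fin n × Fin m) ℂ) :
    Matrix (Fin n × Fin m) (Fin n × Fin m) ℂ :=
  Matrix.of fun a b => ρ (b.1, a.2) (a.1, b.2)

/-- `ρ` is separable if it is a finite sum of projections `z z^*` onto product vectors. -/
def Separable {n m : ℕ} (ρ : Matrix (Fin n × Fin m) (Fin n × Fin m) ℂ) : Prop :=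
  ∃ (k : ℕ) (φ : Fin k → Fin n → ℂ) (ψ : Fin k → Fin m → ℂ),
    ρ = ∑ t, Matrix.vecMulVec (prodVec (φ t) (ψ t)) (star (prodVec (φ t) (ψ t)))

namespace PPTRank

open Matrix

/-- The rank of a block diagonal matrix is the sum of the ranks of its blocks. -/
theorem rank_fromBlocks_diag {m n m' n' : Type*} [Fintype m] [Fintype n] [Fintype m'] [Fintype n']
    (A : Matrix m n ℂ) (D : Matrix m' n' ℂ) :
    (fromBlocks A 0 0 D).rank = A.rank + D.rank := by
  have h : (fromBlocks A 0 0 D).mulVecLin =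
      ((LinearEquiv.sumArrowLequivProdArrow m m' ℂ ℂ).symm.toLinearMap ∘ₗ
        (A.mulVecLin.prodMap D.mulVecLin)) ∘ₗ
        (LinearEquiv.sumArrowLequivProdArrow n n' ℂ ℂ).toLinearMap := by
    ext x i
    rcases i with i | i <;>
    simp [fromBlocks_mulVec, LinearEquiv.sumArrowLequivProdArrow, Equiv.sumArrowEquivProdArrow,
      Function.comp_def]
  rw [Matrix.rank, h, LinearMap.range_comp_of_range_eq_top _ (LinearEquiv.range _),
    LinearMap.range_comp, LinearEquiv.finrank_map_eq, LinearMap.range_prodMap]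
  have e : ((A.mulVecLin.range).prod (D.mulVecLin.range)) ≃ₗ[ℂ]
      (A.mulVecLin.range × D.mulVecLin.range) := 
    { toFun := fun x => (⟨x.1.1, x.2.1⟩, ⟨x.1.2, x.2.2⟩)
      invFun := fun x => ⟨(x.1.1, x.2.1), x.1.2, x.2.2⟩
      map_add' := fun _ _ => rfl
      map_smul' := fun _ _ => rfl }
  rw [e.finrank_eq, Module.finrank_prod]
  rfl

theorem eq_zero_of_rank_eq_zero {m n : Type*} [Fintype m] [Fintype n] {A : Matrix m n ℂ}
    (h : A.rank = 0) : A = 0 := by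
  have h1 : A.mulVecLin.range = ⊥ := Submodule.finrank_eq_zero.mp h
  have h2 : A.mulVecLin = 0 := LinearMap.range_eq_bot.mp h1
  classical
  ext i j
  have := congrFun (LinearMap.congr_fun h2 (Pi.single j 1)) i
  simpa using this

/-- A positive semidefinite matrix of rank `r` factors through `ℂ^r`. -/
theorem exists_factorization {n : Type*} [Fintype n] {P : Matrix n n ℂ} (hP : P.PosSemidef) :
    ∃ C : Matrix (Fin P.rank) n ℂ, P = Cᴴ * C := by
  classical
  have e : {i // hP.1.eigenvalues i ≠ 0} ≃ Fin P.rank :=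
    Fintype.equivFinOfCardEq hP.1.rank_eq_card_non_zero_eigs.symm
  let U := (hP.1.eigenvectorUnitary : Matrix n n ℂ)
  refine ⟨Matrix.of fun k j => (Real.sqrt (hP.1.eigenvalues (e.symm k)) : ℂ) * conj (U j (e.symm k)),
    ?_⟩
  have hs : P = U * diagonal (RCLike.ofReal ∘ hP.1.eigenvalues) * star U := by
    conv_lhs => rw [hP.1.spectral_theorem]
    rfl
  ext i j
  have h1 : P i j = ∑ k, U i k * (hP.1.eigenvalues k : ℂ) * conj (U j k) := by
    conv_lhs => rw [hs]
    rw [Matrix.mul_apply]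
    simp only [Matrix.mul_diagonal, Matrix.star_apply]
    rfl
  rw [h1, Matrix.mul_apply]
  have h2 : ∀ k, U i k * (hP.1.eigenvalues k : ℂ) * conj (U j k) =
      (Real.sqrt (hP.1.eigenvalues k) * U i k) * (Real.sqrt (hP.1.eigenvalues k) * conj (U j k)) := by
    intro k
    have : ((Real.sqrt (hP.1.eigenvalues k) : ℝ) : ℂ) * Real.sqrt (hP.1.eigenvalues k) =
        hP.1.eigenvalues k := by
      rw [← Complex.ofReal_mul, Real.mul_self_sqrt (hP.eigenvalues_nonneg k)]
    rw [← this]; ring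
  have h3 : ∑ k, U i k * (hP.1.eigenvalues k : ℂ) * conj (U j k) =
      ∑ k : {k // hP.1.eigenvalues k ≠ 0}, U i k * (hP.1.eigenvalues k : ℂ) * conj (U j k) := by
    rw [← Finset.sum_subtype (Finset.univ.filter fun k => hP.1.eigenvalues k ≠ 0) (by simp)
      (fun k => U i k * (hP.1.eigenvalues k : ℂ) * conj (U j k)), Finset.sum_filter_of_ne]
    intro k _ hk h0
    simp [h0] at hk
  rw [h3, ← e.symm.sum_comp]
  refine Finset.sum_congr rfl fun k _ => ?_
  rw [h2]
  simp

/-- Rank and positivity of the Schur complement of an identity block. -/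
theorem schur_one {ι κ : Type*} [Fintype ι] [Fintype κ] [DecidableEq ι]
    {M : Matrix (ι ⊕ κ) (ι ⊕ κ) ℂ} (hM : M.PosSemidef) (h1 : M.toBlocks₁₁ = 1) :
    (M.toBlocks₂₂ - M.toBlocks₁₂ᴴ * M.toBlocks₁₂).PosSemidef ∧
      M.rank = Fintype.card ι + (M.toBlocks₂₂ - M.toBlocks₁₂ᴴ * M.toBlocks₁₂).rank := by
  classical
  let _ : Invertible (1 : Matrix ι ι ℂ) := invertibleOne
  have h21 : M.toBlocks₂₁ = M.toBlocks₁₂ᴴ := by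
    ext i j
    exact (hM.1.apply (Sum.inr i) (Sum.inl j)).symm
  have hMb : M = fromBlocks 1 M.toBlocks₁₂ M.toBlocks₁₂ᴴ M.toBlocks₂₂ := by
    rw [← h1, ← h21, fromBlocks_toBlocks]
  constructor
  · have := (PosDef.fromBlocks₁₁ M.toBlocks₁₂ M.toBlocks₂₂ (PosDef.one (n := ι) (R := ℂ))).mp
      (by rw [← hMb]; exact hM)
    simpa using this
  · conv_lhs => rw [hMb, fromBlocks_eq_of_invertible₁₁]
    rw [rank_mul_eq_left_of_isUnit_det, rank_mul_eq_right_of_isUnit_det, rank_fromBlocks_diag,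
      rank_one]
    · simp
    · simp
    · simp

/-- Conjugation of a bipartite matrix by the local operator `A ⊗ B`. -/
noncomputable def loc {n m n' m' : ℕ} (A : Matrix (Fin n) (Fin n') ℂ) (B : Matrix (Fin m) (Fin m') ℂ)
    (ρ : Matrix (Fin n × Fin m) (Fin n × Fin m) ℂ) : Matrix (Fin n' × Fin m') (Fin n' × Fin m') ℂ :=
  (kroneckerMap (· * ·) A B)ᴴ * ρ * kroneckerMap (· * ·) A B

theorem loc_apply {n m n' m' : ℕ} (A : Matrix (Fin n) (Fin n') ℂ) (B : Matrix (Fin m) (Fin m') ℂ)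
    (ρ : Matrix (Fin n × Fin m) (Fin n × Fin m) ℂ) (a b : Fin n' × Fin m') :
    loc A B ρ a b = ∑ i, ∑ k, ∑ j, ∑ l,
      conj (A i a.1) * A k b.1 * (conj (B j a.2) * ρ (i, j) (k, l) * B l b.2) := by
  simp only [loc, Matrix.mul_apply, Fintype.sum_prod_type, Matrix.conjTranspose_apply,
    kroneckerMap_apply, Finset.sum_mul, star_mul', RCLike.star_def]
  have : ∀ k l, ∑ i, ∑ j, conj (A i a.1) * conj (B j a.2) * ρ (i, j) (k, l) * (A k b.1 * B l b.2) =
      ∑ i, ∑ j, conj (A i a.1) * A k b.1 * (conj (B j a.2) * ρ (i, j) (k, l) * B l b.2) := by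
    intro k l
    refine Finset.sum_congr rfl fun i _ => Finset.sum_congr rfl fun j _ => ?_
    ring
  simp only [this]
  have h2 : ∀ k, ∑ l, ∑ i, ∑ j, conj (A i a.1) * A k b.1 * (conj (B j a.2) * ρ (i, j) (k, l) * B l b.2)
      = ∑ i, ∑ j, ∑ l, conj (A i a.1) * A k b.1 * (conj (B j a.2) * ρ (i, j) (k, l) * B l b.2) := by
    intro k
    rw [Finset.sum_comm]
    refine Finset.sum_congr rfl fun i _ => ?_
    rw [Finset.sum_comm]
  simp only [h2]
  rw [Finset.sum_comm]

/-- Partial conjugation turns the local operator `A ⊗ B` into `Ā ⊗ B`. -/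
theorem pt_loc {n m n' m' : ℕ} (A : Matrix (Fin n) (Fin n') ℂ) (B : Matrix (Fin m) (Fin m') ℂ)
    (ρ : Matrix (Fin n × Fin m) (Fin n × Fin m) ℂ) :
    pt (loc A B ρ) = loc (A.map conj) B (pt ρ) := by
  ext a b
  simp only [pt, Matrix.of_apply, loc_apply, Matrix.map_apply, Complex.conj_conj]
  rw [Finset.sum_comm]
  refine Finset.sum_congr rfl fun i _ => Finset.sum_congr rfl fun k _ =>
    Finset.sum_congr rfl fun j _ => Finset.sum_congr rfl fun l _ => ?_
  ring

theorem loc_loc {n m n' m' n'' m'' : ℕ} (A : Matrix (Fin n) (Fin n') ℂ)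
    (B : Matrix (Fin m) (Fin m') ℂ) (A' : Matrix (Fin n') (Fin n'') ℂ)
    (B' : Matrix (Fin m') (Fin m'') ℂ) (ρ : Matrix (Fin n × Fin m) (Fin n × Fin m) ℂ) :
    loc A' B' (loc A B ρ) = loc (A * A') (B * B') ρ := by
  simp only [loc]
  rw [mul_kronecker_mul, conjTranspose_mul]
  simp only [Matrix.mul_assoc]

theorem loc_one {n m : ℕ} (ρ : Matrix (Fin n × Fin m) (Fin n × Fin m) ℂ) :
    loc (1 : Matrix (Fin n) (Fin n) ℂ) (1 : Matrix (Fin m) (Fin m) ℂ) ρ = ρ := by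
  simp [loc]

/-- Positivity of a bipartite matrix together with its partial transpose. -/
def PPT {n m : ℕ} (ρ : Matrix (Fin n × Fin m) (Fin n × Fin m) ℂ) : Prop :=
  ρ.PosSemidef ∧ (pt ρ).PosSemidef

section
variable {n m n' m' : ℕ}

theorem PPT.loc {ρ : Matrix (Fin n × Fin m) (Fin n × Fin m) ℂ} (h : PPT ρ)
    (A : Matrix (Fin n) (Fin n') ℂ) (B : Matrix (Fin m) (Fin m') ℂ) : PPT (loc A B ρ) :=
  ⟨h.1.conjTranspose_mul_mul_same _, by rw [pt_loc]; exact h.2.conjTranspose_mul_mul_same _⟩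

theorem isUnit_det_map_conj {A : Matrix (Fin n) (Fin n) ℂ} (h : IsUnit A.det) :
    IsUnit (A.map conj).det := by
  have : (A.map conj).det = conj A.det := (RingHom.map_det _ A).symm
  rw [this]
  exact h.map _

theorem isUnit_det_kronecker {A : Matrix (Fin n) (Fin n) ℂ} {B : Matrix (Fin m) (Fin m) ℂ}
    (hA : IsUnit A.det) (hB : IsUnit B.det) : IsUnit (kroneckerMap (· * ·) A B).det := by
  rw [det_kronecker]
  exact (hA.pow _).mul (hB.pow _)

theorem rank_loc {A : Matrix (Fin n) (Fin n) ℂ} {B : Matrix (Fin m) (Fin m) ℂ}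
    (hA : IsUnit A.det) (hB : IsUnit B.det) (ρ : Matrix (Fin n × Fin m) (Fin n × Fin m) ℂ) :
    (PPTRank.loc A B ρ).rank = ρ.rank := by
  have h := isUnit_det_kronecker hA hB
  rw [PPTRank.loc, rank_mul_eq_left_of_isUnit_det _ _ h, rank_mul_eq_right_of_isUnit_det]
  rw [det_conjTranspose]
  exact h.star

theorem rank_pt_loc {A : Matrix (Fin n) (Fin n) ℂ} {B : Matrix (Fin m) (Fin m) ℂ}
    (hA : IsUnit A.det) (hB : IsUnit B.det) (ρ : Matrix (Fin n × Fin m) (Fin n × Fin m) ℂ) :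
    (pt (PPTRank.loc A B ρ)).rank = (pt ρ).rank := by
  rw [pt_loc, rank_loc (isUnit_det_map_conj hA) hB]

theorem separable_iff {ρ : Matrix (Fin n × Fin m) (Fin n × Fin m) ℂ} :
    Separable ρ ↔ ∃ (k : ℕ) (φ : Fin k → Fin n → ℂ) (ψ : Fin k → Fin m → ℂ), ∀ i j k' l,
      ρ (i, j) (k', l) = ∑ t, φ t i * ψ t j * (conj (φ t k') * conj (ψ t l)) := by
  unfold Separable
  refine exists_congr fun k => exists_congr fun φ => exists_congr fun ψ => ?_
  constructor
  · rintro rfl i j k' l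
    simp [Matrix.sum_apply, vecMulVec_apply, prodVec]
  · intro h
    ext ⟨i, j⟩ ⟨k', l⟩
    simp [h, Matrix.sum_apply, vecMulVec_apply, prodVec]

theorem separable_zero : Separable (0 : Matrix (Fin n × Fin m) (Fin n × Fin m) ℂ) :=
  separable_iff.mpr ⟨0, fun _ _ => 0, fun _ _ => 0, by simp⟩

theorem separable_add {ρ σ : Matrix (Fin n × Fin m) (Fin n × Fin m) ℂ} (hρ : Separable ρ)
    (hσ : Separable σ) : Separable (ρ + σ) := by
  obtain ⟨k, φ, ψ, h⟩ := separable_iff.mp hρ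
  obtain ⟨k', φ', ψ', h'⟩ := separable_iff.mp hσ
  refine separable_iff.mpr ⟨k + k', Fin.append φ φ', Fin.append ψ ψ', fun i j k l => ?_⟩
  simp [Fin.sum_univ_add, h, h']

theorem separable_smul {ρ : Matrix (Fin n × Fin m) (Fin n × Fin m) ℂ} (hρ : Separable ρ)
    {c : ℝ} (hc : 0 ≤ c) : Separable ((c : ℂ) • ρ) := by
  obtain ⟨k, φ, ψ, h⟩ := separable_iff.mp hρ
  refine separable_iff.mpr ⟨k, fun t i => (Real.sqrt c : ℂ) * φ t i, ψ, fun i j k l => ?_⟩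
  have hs : (c : ℂ) = Real.sqrt c * Real.sqrt c := by
    rw [← Complex.ofReal_mul, Real.mul_self_sqrt hc]
  simp only [Matrix.smul_apply, h, smul_eq_mul, Finset.mul_sum, map_mul, Complex.conj_ofReal]
  rw [hs]
  refine Finset.sum_congr rfl fun t _ => ?_
  ring

theorem PPT.pt {ρ : Matrix (Fin n × Fin m) (Fin n × Fin m) ℂ} (h : PPT ρ) : PPT (pt ρ) :=
  ⟨h.2, h.1⟩

theorem separable_prodVec (φ : Fin n → ℂ) (ψ : Fin m → ℂ) :
    Separable (vecMulVec (prodVec φ ψ) (star (prodVec φ ψ))) :=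
  ⟨1, fun _ => φ, fun _ => ψ, by simp⟩

theorem separable_loc {ρ : Matrix (Fin n × Fin m) (Fin n × Fin m) ℂ} (hρ : Separable ρ)
    (A : Matrix (Fin n) (Fin n') ℂ) (B : Matrix (Fin m) (Fin m') ℂ) :
    Separable (PPTRank.loc A B ρ) := by
  obtain ⟨k, φ, ψ, rfl⟩ := hρ
  refine ⟨k, fun t => Aᴴ *ᵥ φ t, fun t => Bᴴ *ᵥ ψ t, ?_⟩
  have hp : ∀ (φ : Fin n → ℂ) (ψ : Fin m → ℂ),
      (kroneckerMap (· * ·) A B)ᴴ *ᵥ prodVec φ ψ = prodVec (Aᴴ *ᵥ φ) (Bᴴ *ᵥ ψ) := by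
    intro φ ψ
    ext ⟨i, j⟩
    simp only [mulVec, dotProduct, prodVec, Fintype.sum_prod_type, conjTranspose_apply,
      kroneckerMap_apply, Finset.sum_mul_sum, star_mul']
    refine Finset.sum_congr rfl fun _ _ => Finset.sum_congr rfl fun _ _ => ?_
    ring
  rw [PPTRank.loc, Matrix.mul_sum, Matrix.sum_mul]
  refine Finset.sum_congr rfl fun t _ => ?_
  rw [mul_vecMulVec, vecMulVec_mul, ← hp, star_mulVec, conjTranspose_conjTranspose]

theorem separable_of_loc {ρ : Matrix (Fin n × Fin m) (Fin n × Fin m) ℂ}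
    {A : Matrix (Fin n) (Fin n) ℂ} {B : Matrix (Fin m) (Fin m) ℂ}
    (hA : IsUnit A.det) (hB : IsUnit B.det) (h : Separable (PPTRank.loc A B ρ)) : Separable ρ := by
  have := separable_loc h A⁻¹ B⁻¹
  rwa [loc_loc, mul_nonsing_inv _ hA, mul_nonsing_inv _ hB, loc_one] at this

end

/-- The dimension of the space of ternary forms of degree `e`. -/
theorem finrank_ternary_forms (e : ℕ) :
    Module.finrank ℂ (MvPolynomial.homogeneousSubmodule (Fin 3) ℂ e) = (e + 2).choose 2 := by
  have h : {d : Fin 3 →₀ ℕ | d.degree = e} =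
      ((Finset.univ : Finset (Fin 3)).finsuppAntidiag e : Set (Fin 3 →₀ ℕ)) := by
    ext d
    simp [Finset.mem_finsuppAntidiag, Finsupp.degree_eq_sum]
  rw [MvPolynomial.homogeneousSubmodule_eq_finsupp_supported, AddMonoidAlgebra.supported_eq_map, h]
  refine (LinearEquiv.finrank_map_eq (AddMonoidAlgebra.coeffLinearEquiv ℂ).symm _).trans ?_
  rw [(Finsupp.supportedEquivFinsupp _).finrank_eq, Module.finrank_finsupp_self]
  simp only [Finset.coe_sort_coe, Fintype.card_coe]
  rw [Finset.card_finsuppAntidiag_nat_eq_choose]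
  simp only [Finset.card_univ, Fintype.card_fin]
  rw [show 3 + e - 1 = e + 2 by omega, ← Nat.choose_symm_add]

theorem exists_det_snoc_ne_zero {M : Matrix (Fin 4) (Fin 3) ℂ}
    (hM : ∀ b : Fin 3 → ℂ, M *ᵥ b = 0 → b = 0) :
    ∃ v : Fin 4 → ℂ, (Matrix.of fun k => (Fin.snoc (M k) (v k) : Fin 4 → ℂ)).det ≠ 0 := by
  have hli : LinearIndependent ℂ (fun j k => M k j : Fin 3 → Fin 4 → ℂ) := by
    rw [Fintype.linearIndependent_iff]
    intro g hg
    refine fun i => congrFun (hM g ?_) i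
    ext k
    have := congrFun hg k
    simpa [mulVec, dotProduct, mul_comm, Finset.sum_apply] using this
  have hspan : ∃ v : Fin 4 → ℂ,
      v ∉ Submodule.span ℂ (Set.range (fun j k => M k j : Fin 3 → Fin 4 → ℂ)) := by
    by_contra! hcon
    have h1 := (Submodule.eq_top_iff').mpr hcon
    have h2 := finrank_span_eq_card hli
    rw [h1] at h2
    simp at h2
  obtain ⟨v, hv⟩ := hspan
  refine ⟨v, ?_⟩
  have h3 := hli.finSnoc hv
  have h4 : (Matrix.of fun k => (Fin.snoc (M k) (v k) : Fin 4 → ℂ)) =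
      (Matrix.of (Fin.snoc (fun j k => M k j : Fin 3 → Fin 4 → ℂ) v : Fin 4 → Fin 4 → ℂ))ᵀ := by
    ext k j
    refine Fin.lastCases ?_ (fun j => ?_) j
    · simp only [of_apply, transpose_apply, Fin.snoc_last]
    · simp only [of_apply, transpose_apply, Fin.snoc_castSucc]
  rw [h4, det_transpose]
  have h5 := Matrix.linearIndependent_rows_iff_isUnit.mp
    (show LinearIndependent ℂ (Matrix.of
      (Fin.snoc (fun j k => M k j : Fin 3 → Fin 4 → ℂ) v : Fin 4 → Fin 4 → ℂ)).row from h3)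
  exact ((Matrix.isUnit_iff_isUnit_det _).mp h5).ne_zero

open MvPolynomial in
theorem homogeneousComponent_mul_of_isHomogeneous {p q : MvPolynomial (Fin 3) ℂ} {m : ℕ}
    (hq : q.IsHomogeneous m) (d : ℕ) :
    homogeneousComponent (d + m) (p * q) = homogeneousComponent d p * q := by
  let _ := MvPolynomial.gradedAlgebra (σ := Fin 3) (R := ℂ)
  have := DirectSum.coe_decompose_mul_of_right_mem_of_le (homogeneousSubmodule (Fin 3) ℂ) (a := p)
    (b := q) (i := m) (n := d + m) hq (by omega)
  rw [Nat.add_sub_cancel] at this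
  have e : ∀ (f : MvPolynomial (Fin 3) ℂ) i, homogeneousComponent i f =
      (DirectSum.decompose (homogeneousSubmodule (Fin 3) ℂ) f i : MvPolynomial (Fin 3) ℂ) :=
    fun f i => (decomposition.decompose'_apply f i).symm
  rw [e, e, this]

open MvPolynomial in
/-- Forms of large degree belong to an ideal generated by forms without common projective zero. -/
theorem exists_forall_isHomogeneous_mem {ι : Type*} (l : ι → MvPolynomial (Fin 3) ℂ)
    (hl : ∀ a : Fin 3 → ℂ, (∀ k, eval a (l k) = 0) → a = 0) :
    ∃ N, ∀ e ≥ N, ∀ f : MvPolynomial (Fin 3) ℂ, f.IsHomogeneous e →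
      f ∈ Ideal.span (Set.range l) := by
  set I := Ideal.span (Set.range l)
  have hX : ∀ i, ∃ n, (X i : MvPolynomial (Fin 3) ℂ) ^ n ∈ I := by
    intro i
    have : (X i : MvPolynomial (Fin 3) ℂ) ∈ vanishingIdeal ℂ (zeroLocus ℂ I) := by
      rw [mem_vanishingIdeal_iff]
      intro x hx
      have hx0 : x = 0 := hl x fun k => by
        have := (mem_zeroLocus_iff.mp hx) (l k) (Ideal.subset_span ⟨k, rfl⟩)
        rwa [aeval_eq_eval] at this
      simp [hx0]
    rw [vanishingIdeal_zeroLocus_eq_radical] at this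
    exact this
  choose n hn using hX
  refine ⟨n 0 + n 1 + n 2, fun e he f hf => ?_⟩
  rw [f.as_sum]
  refine Ideal.sum_mem _ fun d hd => ?_
  have hdeg : d 0 + d 1 + d 2 = e := by
    rw [hf.degree_eq_sum_deg_support hd, ← Fin.sum_univ_three d]
    exact (Finset.sum_subset (Finset.subset_univ _) (by simp)).symm
  have : ∃ i, n i ≤ d i := by
    by_contra! hcon
    have h0 := hcon 0
    have h1 := hcon 1
    have h2 := hcon 2
    omega
  obtain ⟨i, hi⟩ := this
  rw [monomial_eq, Finsupp.prod_fintype _ _ (by simp)]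
  refine Ideal.mul_mem_left _ _ ?_
  rw [← Finset.mul_prod_erase _ _ (Finset.mem_univ i)]
  exact Ideal.mul_mem_right _ _ (Ideal.pow_mem_of_pow_mem _ (hn i) hi)

section
open MvPolynomial

/-- The linear pencil `∑ i, x i • M i`, as a matrix of linear forms. -/
noncomputable def pencil (M : Fin 3 → Matrix (Fin 4) (Fin 3) ℂ) (k : Fin 4) (j : Fin 3) :
    MvPolynomial (Fin 3) ℂ :=
  ∑ i, C (M i k j) * X i

/-- The pencil together with a last column. -/
noncomputable def bordered (M : Fin 3 → Matrix (Fin 4) (Fin 3) ℂ)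
    (v : Fin 4 → MvPolynomial (Fin 3) ℂ) : Matrix (Fin 4) (Fin 4) (MvPolynomial (Fin 3) ℂ) :=
  Matrix.of fun k => Fin.snoc (pencil M k) (v k)

variable (M : Fin 3 → Matrix (Fin 4) (Fin 3) ℂ)

theorem bordered_castSucc (v : Fin 4 → MvPolynomial (Fin 3) ℂ) (k : Fin 4) (j : Fin 3) :
    bordered M v k j.castSucc = pencil M k j :=
  Fin.snoc_castSucc (α := fun _ : Fin 4 => MvPolynomial (Fin 3) ℂ) _ _ _

theorem bordered_last (v : Fin 4 → MvPolynomial (Fin 3) ℂ) (k : Fin 4) :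
    bordered M v k (Fin.last 3) = v k :=
  Fin.snoc_last (α := fun _ : Fin 4 => MvPolynomial (Fin 3) ℂ) (v k) (pencil M k)

theorem pencil_isHomogeneous (k : Fin 4) (j : Fin 3) : (pencil M k j).IsHomogeneous 1 :=
  IsHomogeneous.sum _ _ _ fun _ _ => isHomogeneous_C_mul_X _ _

theorem eval_pencil (a : Fin 3 → ℂ) (k : Fin 4) (j : Fin 3) :
    eval a (pencil M k j) = (∑ i, a i • M i) k j := by
  simp [pencil, Matrix.sum_apply, mul_comm]

theorem det_bordered (v : Fin 4 → MvPolynomial (Fin 3) ℂ) :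
    (bordered M v).det = ∑ k, v k * (bordered M (Pi.single k 1)).det := by
  have h : ∀ v, (bordered M v).det = cramer (bordered M 0) v (Fin.last 3) := by
    intro v
    rw [cramer_apply]
    congr 1
    ext k j : 2
    refine Fin.lastCases ?_ (fun j => ?_) j
    · rw [bordered_last, updateCol_self]
    · rw [bordered_castSucc, updateCol_ne (Fin.castSucc_ne_last j), bordered_castSucc]
  have hv : v = ∑ k, v k • (Pi.single k 1 : Fin 4 → MvPolynomial (Fin 3) ℂ) := by
    ext1 k
    simp [Finset.sum_apply, Pi.single_apply]
  rw [h]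
  conv_lhs => rw [hv]
  rw [map_sum, Finset.sum_apply]
  refine Finset.sum_congr rfl fun k _ => ?_
  rw [map_smul, Pi.smul_apply, smul_eq_mul, h]

theorem det_bordered_isHomogeneous (k : Fin 4) :
    (bordered M (Pi.single k 1)).det.IsHomogeneous 3 := by
  rw [det_apply]
  refine IsHomogeneous.sum _ _ _ fun σ _ => ?_
  have h : (∏ i, bordered M (Pi.single k 1) (σ i) i).IsHomogeneous
      (∑ i : Fin 4, if i = Fin.last 3 then 0 else 1) := by
    refine IsHomogeneous.prod _ _ _ fun i _ => ?_
    refine Fin.lastCases ?_ (fun j => ?_) i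
    · simp only [bordered_last, if_true, Pi.single_apply]
      split_ifs
      · exact isHomogeneous_one _ _
      · exact isHomogeneous_zero _ _ _
    · simp only [bordered_castSucc, Fin.castSucc_ne_last, if_false]
      exact pencil_isHomogeneous M _ _
  have h3 : (∑ i : Fin 4, if i = Fin.last 3 then 0 else 1) = 3 := by decide
  rw [h3] at h
  rcases Int.units_eq_one_or (Equiv.Perm.sign σ) with hs | hs
  · simpa [hs] using h
  · simpa [hs] using h.neg

theorem sum_pencil_mul_det (j : Fin 3) :
    ∑ k, pencil M k j * (bordered M (Pi.single k 1)).det = 0 := by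
  rw [← det_bordered]
  refine det_zero_of_column_eq (i := j.castSucc) (j := Fin.last 3) (Fin.castSucc_ne_last j) ?_
  intro k
  rw [bordered_castSucc, bordered_last]

theorem eval_det_bordered (a : Fin 3 → ℂ) (v : Fin 4 → ℂ) :
    eval a (bordered M fun k => C (v k)).det =
      (Matrix.of fun k => (Fin.snoc ((∑ i, a i • M i) k) (v k) : Fin 4 → ℂ)).det := by
  rw [RingHom.map_det]
  congr 1
  ext k j
  refine Fin.lastCases ?_ (fun j => ?_) j
  · rw [RingHom.mapMatrix_apply, Matrix.map_apply, bordered_last, of_apply, Fin.snoc_last, eval_C]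
  · rw [RingHom.mapMatrix_apply, Matrix.map_apply, bordered_castSucc, of_apply, Fin.snoc_castSucc,
      eval_pencil]

/-- A `3`-dimensional linear system of `4 × 3` matrices contains a matrix with nonzero kernel. -/
theorem exists_pencil_kernel :
    ∃ a b : Fin 3 → ℂ, a ≠ 0 ∧ b ≠ 0 ∧ (∑ i, a i • M i) *ᵥ b = 0 := by
  by_contra! hcon
  have hinj : ∀ a : Fin 3 → ℂ, a ≠ 0 → ∀ b, (∑ i, a i • M i) *ᵥ b = 0 → b = 0 := by
    intro a ha b hb
    by_contra hb0
    exact hcon a b ha hb0 hb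
  set l : Fin 4 → MvPolynomial (Fin 3) ℂ := fun k => (bordered M (Pi.single k 1)).det with hldef
  obtain ⟨N, hN⟩ := exists_forall_isHomogeneous_mem l (by
    intro a ha
    by_contra ha0
    obtain ⟨v, hv⟩ := exists_det_snoc_ne_zero (hinj a ha0)
    rw [← eval_det_bordered, det_bordered, map_sum] at hv
    exact hv (Finset.sum_eq_zero fun k _ => by rw [map_mul, ha k, mul_zero]))
  let S := homogeneousSubmodule (Fin 3) ℂ
  let Φ : (Fin 4 → S (N + 1)) →ₗ[ℂ] S (N + 1 + 3) :=
    LinearMap.codRestrict _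
      (∑ k, (LinearMap.mulRight ℂ (l k)) ∘ₗ (S (N + 1)).subtype ∘ₗ LinearMap.proj k)
      (fun u => by
        simp only [LinearMap.sum_apply, LinearMap.comp_apply]
        exact Submodule.sum_mem _ fun k _ => (u k).2.mul (det_bordered_isHomogeneous M k))
  let Ψ : (Fin 3 → S N) →ₗ[ℂ] (Fin 4 → S (N + 1)) :=
    LinearMap.pi fun k => LinearMap.codRestrict _
      (∑ j, (LinearMap.mulRight ℂ (pencil M k j)) ∘ₗ (S N).subtype ∘ₗ LinearMap.proj j)
      (fun u => by
        simp only [LinearMap.sum_apply, LinearMap.comp_apply]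
        exact Submodule.sum_mem _ fun j _ => (u j).2.mul (pencil_isHomogeneous M k j))
  have hΦ : ∀ u, (Φ u : MvPolynomial (Fin 3) ℂ) = ∑ k, (u k : MvPolynomial (Fin 3) ℂ) * l k := by
    intro u
    simp [Φ]
  have hΨ : ∀ w k, (Ψ w k : MvPolynomial (Fin 3) ℂ) =
      ∑ j, (w j : MvPolynomial (Fin 3) ℂ) * pencil M k j := by
    intro w k
    simp [Ψ]
  have hsurj : LinearMap.range Φ = ⊤ := by
    rw [LinearMap.range_eq_top]
    intro f
    obtain ⟨u, hu⟩ := Ideal.mem_span_range_iff_exists_fun.mp (hN (N + 1 + 3) (by omega) f f.2)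
    refine ⟨fun k => ⟨homogeneousComponent (N + 1) (u k), homogeneousComponent_mem _ _⟩, ?_⟩
    apply Subtype.ext
    rw [hΦ]
    have h2 := congrArg (homogeneousComponent (N + 1 + 3)) hu
    rw [map_sum, homogeneousComponent_of_mem f.2, if_pos rfl] at h2
    rw [← h2]
    exact Finset.sum_congr rfl fun k _ =>
      (homogeneousComponent_mul_of_isHomogeneous (det_bordered_isHomogeneous M k) _).symm
  have hΨinj : Function.Injective Ψ := by
    rw [injective_iff_map_eq_zero]
    intro w hw
    have hpt : ∀ a : Fin 3 → ℂ, a ≠ 0 → ∀ j, eval a (w j : MvPolynomial (Fin 3) ℂ) = 0 := by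
      intro a ha j
      refine congrFun (hinj a ha (fun j => eval a (w j : MvPolynomial (Fin 3) ℂ)) ?_) j
      ext k
      have h1 := congrArg (eval a) ((hΨ w k).symm.trans (by rw [hw]; rfl : _ = (0 : MvPolynomial (Fin 3) ℂ)))
      simp only [map_sum, map_mul, eval_pencil, map_zero] at h1
      simp only [mulVec, dotProduct, Pi.zero_apply]
      rw [← h1]
      exact Finset.sum_congr rfl fun _ _ => mul_comm _ _
    ext1 j
    apply Subtype.ext
    have h0 : (w j : MvPolynomial (Fin 3) ℂ) * X 0 = 0 := by
      refine MvPolynomial.funext fun a => ?_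
      by_cases ha : a = 0
      · simp [ha]
      · simp [hpt a ha j]
    exact (mul_eq_zero.mp h0).resolve_right (X_ne_zero 0)
  have hle : LinearMap.range Ψ ≤ LinearMap.ker Φ := by
    rintro _ ⟨w, rfl⟩
    rw [LinearMap.mem_ker]
    apply Subtype.ext
    rw [hΦ]
    simp only [hΨ, Finset.sum_mul]
    rw [Finset.sum_comm]
    refine Finset.sum_eq_zero fun j _ => ?_
    have := sum_pencil_mul_det M j
    simp only [mul_assoc, ← Finset.mul_sum]
    rw [this, mul_zero]
  have hfd : ∀ e, Module.Finite ℂ (S e) := by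
    intro e
    refine Module.finite_of_finrank_pos ?_
    rw [finrank_ternary_forms]
    exact Nat.choose_pos (by omega)
  have h1 := Submodule.finrank_mono hle
  have h2 := LinearMap.finrank_range_add_finrank_ker Φ
  rw [LinearMap.finrank_range_of_inj hΨinj] at h1
  rw [hsurj, finrank_top] at h2
  simp only [Module.finrank_pi_fintype, S, finrank_ternary_forms, Finset.sum_const,
    Finset.card_univ, Fintype.card_fin, smul_eq_mul] at h1 h2
  have hc : ∀ e, 2 * (e + 2).choose 2 = (e + 2) * (e + 1) := by
    intro e
    rw [Nat.choose_two_right, Nat.mul_div_cancel' (Nat.even_mul_pred_self (e + 2)).two_dvd]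
    rfl
  have c0 := hc N
  have c1 := hc (N + 1)
  have c2 := hc (N + 1 + 3)
  nlinarith
end

/-- A positive matrix of rank four on `ℂ³ ⊗ ℂ³` annihilates a product vector. -/
theorem exists_prodVec_mem_ker {ρ : Matrix (Fin 3 × Fin 3) (Fin 3 × Fin 3) ℂ} (h : ρ.PosSemidef)
    (hr : ρ.rank = 4) : ∃ a b : Fin 3 → ℂ, a ≠ 0 ∧ b ≠ 0 ∧ ρ *ᵥ prodVec a b = 0 := by
  obtain ⟨C, hC⟩ : ∃ C : Matrix (Fin 4) (Fin 3 × Fin 3) ℂ, ρ = Cᴴ * C := by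
    rw [← hr]
    exact exists_factorization h
  obtain ⟨a, b, ha, hb, hab⟩ := exists_pencil_kernel fun i => Matrix.of fun k j => C k (i, j)
  refine ⟨a, b, ha, hb, ?_⟩
  have h0 : C *ᵥ prodVec a b = 0 := by
    rw [← hab]
    ext k
    simp only [mulVec, dotProduct, prodVec, Fintype.sum_prod_type, Matrix.sum_apply,
      Matrix.smul_apply, of_apply, smul_eq_mul, Finset.sum_mul]
    rw [Finset.sum_comm]
    refine Finset.sum_congr rfl fun _ _ => Finset.sum_congr rfl fun _ _ => ?_
    ring
  rw [hC, ← mulVec_mulVec, h0, mulVec_zero]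

/-- If a positive semidefinite matrix restricts to the identity on the indices satisfying `p`, then
it has minimal rank iff the trace of the Schur complement vanishes. -/
theorem rank_eq_card_iff {α : Type*} [Fintype α] [DecidableEq α] {M : Matrix α α ℂ}
    (hM : M.PosSemidef) (p : α → Prop) [DecidablePred p]
    (h1 : ∀ x y, p x → p y → M x y = if x = y then 1 else 0) :
    M.rank = Fintype.card {x // p x} ↔
      (∑ x, if p x then 0 else (M x x - ∑ y, if p y then conj (M y x) * M y x else 0)) = 0 := by
  set N := M.submatrix (Equiv.sumCompl p) (Equiv.sumCompl p) with hN
  have hNps : N.PosSemidef := hM.submatrix _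
  obtain ⟨hS, hr⟩ := schur_one hNps (by
    ext x y
    simp only [hN, toBlocks₁₁, submatrix_apply, of_apply, Equiv.sumCompl_apply_inl, one_apply]
    rw [h1 _ _ x.2 y.2]
    simp [Subtype.ext_iff])
  have hrN : N.rank = M.rank := rank_submatrix _ _ _
  have htr : (N.toBlocks₂₂ - N.toBlocks₁₂ᴴ * N.toBlocks₁₂).trace =
      ∑ x, if p x then 0 else (M x x - ∑ y, if p y then conj (M y x) * M y x else 0) := by
    rw [← Equiv.sum_comp (Equiv.sumCompl p), Fintype.sum_sum_type]
    have hl : ∀ x : {x // p x}, p (Equiv.sumCompl p (Sum.inl x)) := fun x => x.2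
    have hr : ∀ x : {x // ¬ p x}, ¬ p (Equiv.sumCompl p (Sum.inr x)) := fun x => x.2
    rw [Finset.sum_eq_zero (fun x _ => if_pos (hl x)), zero_add]
    refine Finset.sum_congr rfl fun x _ => ?_
    rw [if_neg (hr x), ← Equiv.sum_comp (Equiv.sumCompl p), Fintype.sum_sum_type]
    simp only [hl, hr, if_true, if_false, Finset.sum_const_zero, add_zero]
    rfl
  rw [← htr, hS.trace_eq_zero_iff, ← hrN, hr]
  constructor
  · intro h
    exact eq_zero_of_rank_eq_zero (by omega)
  · intro h
    rw [h, rank_zero, add_zero]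

theorem apply_eq_zero_of_diag_eq_zero {α : Type*} [Fintype α] {M : Matrix α α ℂ}
    (hM : M.PosSemidef) {x : α} (hx : M x x = 0) (y : α) : M x y = 0 ∧ M y x = 0 := by
  classical
  have h := (hM.dotProduct_mulVec_zero_iff (Pi.single x 1)).mp (by
    simp [mulVec_single, hx])
  have hy : M y x = 0 := by simpa using congrFun h y
  exact ⟨by rw [← hM.1.apply, hy, star_zero], hy⟩

theorem rank_pt_of_normal_form {σ : Matrix (Fin 3 × Fin 3) (Fin 3 × Fin 3) ℂ} (hσ : PPT σ)
    (hr : σ.rank = 4) (h0 : σ (0, 0) (0, 0) = 0)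
    (h1 : ∀ α β, α ≠ 0 → β ≠ 0 → σ (0, α) (0, β) = if α = β then 1 else 0)
    (h2 : ∀ i j, i ≠ 0 → j ≠ 0 → σ (i, 0) (j, 0) = if i = j then 1 else 0) :
    (pt σ).rank = 4 := by
  have z1 := fun y => (apply_eq_zero_of_diag_eq_zero hσ.1 h0 y).1
  have z2 := fun y => (apply_eq_zero_of_diag_eq_zero hσ.1 h0 y).2
  have z3 : ∀ i α, σ (i, 0) (0, α) = 0 := fun i α =>
    (apply_eq_zero_of_diag_eq_zero hσ.2 (x := (0, 0)) h0 (i, α)).1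
  have z4 : ∀ i α, σ (0, α) (i, 0) = 0 := fun i α =>
    (apply_eq_zero_of_diag_eq_zero hσ.2 (x := (0, 0)) h0 (i, α)).2
  let p : Fin 3 × Fin 3 → Prop := fun x => ¬ (x.1 = 0 ↔ x.2 = 0)
  have hcard : Fintype.card {x // p x} = 4 := by decide
  have hp : ∀ M : Matrix (Fin 3 × Fin 3) (Fin 3 × Fin 3) ℂ, (M = σ ∨ M = pt σ) →
      ∀ x y, p x → p y → M x y = if x = y then 1 else 0 := by
    clear hcard hr
    rintro M hM ⟨i, α⟩ ⟨j, β⟩ hx hy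
    simp only [p] at hx hy
    by_cases hi : i = 0 <;> by_cases hj : j = 0 <;> by_cases hα : α = 0 <;>
      by_cases hβ : β = 0 <;> rcases hM with rfl | rfl <;>
      simp_all [pt, Ne.symm, eq_comm (a := j)]
  have e1 := rank_eq_card_iff hσ.1 p (hp σ (Or.inl rfl))
  have e2 := rank_eq_card_iff hσ.2 p (hp _ (Or.inr rfl))
  rw [hcard] at e1 e2
  refine e2.mpr (Eq.trans ?_ (e1.mp hr))
  have c1 : ∀ b d, σ (1, b) (0, d) = conj (σ (0, d) (1, b)) := fun b d => (hσ.1.1.apply _ _).symm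
  have c2 : ∀ b d, σ (2, b) (0, d) = conj (σ (0, d) (2, b)) := fun b d => (hσ.1.1.apply _ _).symm
  simp only [Fintype.sum_prod_type, Fin.sum_univ_three, p, pt, of_apply, c1, c2]
  simp [z1, z2]
  ring

section
variable {n m n' m' : ℕ}

/-- The sesquilinear compression `⟨a, ρ b⟩` of `ρ` in the first subsystem. -/
noncomputable def blk (ρ : Matrix (Fin n × Fin m) (Fin n × Fin m) ℂ) (a b : Fin n → ℂ) :
    Matrix (Fin m) (Fin m) ℂ :=
  Matrix.of fun j l => ∑ i, ∑ k, conj (a i) * b k * ρ (i, j) (k, l)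

theorem loc_eq_blk (A : Matrix (Fin n) (Fin n') ℂ) (B : Matrix (Fin m) (Fin m') ℂ)
    (ρ : Matrix (Fin n × Fin m) (Fin n × Fin m) ℂ) (i k : Fin n') (j l : Fin m') :
    loc A B ρ (i, j) (k, l) =
      (Bᴴ * blk ρ (fun x => A x i) (fun x => A x k) * B) j l := by
  rw [loc_apply, Matrix.mul_apply]
  simp only [Matrix.mul_apply, conjTranspose_apply, blk, of_apply, Finset.mul_sum,
    Finset.sum_mul, RCLike.star_def]
  simp only [Finset.sum_comm (γ := Fin m) (α := Fin n)]
  refine Finset.sum_congr rfl fun _ _ => Finset.sum_congr rfl fun _ _ => ?_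
  rw [Finset.sum_comm]
  refine Finset.sum_congr rfl fun _ _ => Finset.sum_congr rfl fun _ _ => ?_
  ring

theorem blk_posSemidef {ρ : Matrix (Fin n × Fin m) (Fin n × Fin m) ℂ} (h : ρ.PosSemidef)
    (a : Fin n → ℂ) : (blk ρ a a).PosSemidef := by
  have h1 : (loc (Matrix.of fun i (_ : Fin 1) => a i) (1 : Matrix (Fin m) (Fin m) ℂ) ρ).PosSemidef :=
    h.conjTranspose_mul_mul_same _
  have h2 : blk ρ a a = (loc (Matrix.of fun i (_ : Fin 1) => a i) 1 ρ).submatrix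
      (fun j => (0, j)) (fun j => (0, j)) := by
    ext j l
    rw [submatrix_apply, loc_eq_blk]
    simp
  rw [h2]
  exact h1.submatrix _

theorem blk_pt (ρ : Matrix (Fin n × Fin m) (Fin n × Fin m) ℂ) (a b : Fin n → ℂ) :
    blk (pt ρ) a b = blk ρ (fun i => conj (b i)) (fun i => conj (a i)) := by
  ext j l
  simp only [blk, of_apply, pt]
  rw [Finset.sum_comm]
  refine Finset.sum_congr rfl fun _ _ => Finset.sum_congr rfl fun _ _ => ?_
  rw [Complex.conj_conj]
  ring

theorem mulVec_prodVec (ρ : Matrix (Fin n × Fin m) (Fin n × Fin m) ℂ) (a : Fin n → ℂ)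
    (b : Fin m → ℂ) (c : Fin n → ℂ) (j : Fin m) :
    (blk ρ c a *ᵥ b) j = ∑ i, conj (c i) * (ρ *ᵥ prodVec a b) (i, j) := by
  simp only [mulVec, dotProduct, blk, of_apply, prodVec, Fintype.sum_prod_type, Finset.sum_mul,
    Finset.mul_sum]
  rw [Finset.sum_comm]
  refine Finset.sum_congr rfl fun _ _ => ?_
  rw [Finset.sum_comm]
  refine Finset.sum_congr rfl fun _ _ => Finset.sum_congr rfl fun _ _ => ?_
  ring

/-- Exchange of the two subsystems. -/
def swap (ρ : Matrix (Fin n × Fin m) (Fin n × Fin m) ℂ) :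
    Matrix (Fin m × Fin n) (Fin m × Fin n) ℂ :=
  ρ.submatrix Prod.swap Prod.swap

theorem loc_swap (A : Matrix (Fin n) (Fin n') ℂ) (B : Matrix (Fin m) (Fin m') ℂ)
    (ρ : Matrix (Fin n × Fin m) (Fin n × Fin m) ℂ) (i k : Fin n') (j l : Fin m') :
    loc A B ρ (i, j) (k, l) = loc B A (swap ρ) (j, i) (l, k) := by
  simp only [loc_apply, swap, submatrix_apply, Prod.swap_prod_mk]
  simp only [Finset.sum_comm (γ := Fin m) (α := Fin n)]
  refine Finset.sum_congr rfl fun _ _ => Finset.sum_congr rfl fun _ _ => ?_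
  exact Finset.sum_congr rfl fun _ _ => Finset.sum_congr rfl fun _ _ => by ring

theorem PPT.swap {ρ : Matrix (Fin n × Fin m) (Fin n × Fin m) ℂ} (h : PPT ρ) : PPT (swap ρ) := by
  refine ⟨h.1.submatrix _, ?_⟩
  have : _root_.pt (PPTRank.swap ρ) = (_root_.pt ρ)ᵀ.submatrix Prod.swap Prod.swap := by
    ext x y
    rfl
  rw [this]
  exact h.2.transpose.submatrix _

theorem separable_of_swap {ρ : Matrix (Fin n × Fin m) (Fin n × Fin m) ℂ}
    (h : Separable (swap ρ)) : Separable ρ := by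
  obtain ⟨k, φ, ψ, h⟩ := separable_iff.mp h
  refine separable_iff.mpr ⟨k, ψ, φ, fun i j k' l => ?_⟩
  have := h j i l k'
  simp only [swap, submatrix_apply, Prod.swap_prod_mk] at this
  rw [this]
  exact Finset.sum_congr rfl fun _ _ => by ring

theorem swap_mulVec (ρ : Matrix (Fin n × Fin m) (Fin n × Fin m) ℂ) (a : Fin n → ℂ)
    (b : Fin m → ℂ) (h : ρ *ᵥ prodVec a b = 0) : swap ρ *ᵥ prodVec b a = 0 := by
  ext ⟨j, i⟩
  refine Eq.trans ?_ (congrFun h (i, j))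
  simp only [mulVec, dotProduct, swap, submatrix_apply, prodVec, Prod.swap_prod_mk,
    Fintype.sum_prod_type]
  rw [Finset.sum_comm]
  exact Finset.sum_congr rfl fun _ _ => Finset.sum_congr rfl fun _ _ => by ring
end

theorem exists_normalizing {G : Matrix (Fin 3) (Fin 3) ℂ} (hG : G.PosSemidef) {b : Fin 3 → ℂ}
    (hb : b ≠ 0) (hGb : G *ᵥ b = 0) (hr : G.rank = 2) :
    ∃ B : Matrix (Fin 3) (Fin 3) ℂ, IsUnit B.det ∧ (fun i => B i 0) = b ∧
      Bᴴ * G * B = diagonal ![0, 1, 1] := by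
  obtain ⟨L, hL⟩ : ∃ L : Matrix (Fin 2) (Fin 3) ℂ, G = Lᴴ * L := by
    rw [← hr]
    exact exists_factorization hG
  have hLb : L *ᵥ b = 0 := by
    rwa [hL, conjTranspose_mul_self_mulVec_eq_zero] at hGb
  have hsurj : Function.Surjective L.mulVec := by
    have h1 : L.mulVecLin.range = ⊤ := by
      apply Submodule.eq_top_of_finrank_eq
      rw [hL, rank_conjTranspose_mul_self] at hr
      rw [Module.finrank_fin_fun]
      exact hr
    exact LinearMap.range_eq_top.mp h1
  obtain ⟨R, hR⟩ := mulVec_surjective_iff_exists_right_inverse.mp hsurj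
  let B : Matrix (Fin 3) (Fin 3) ℂ := Matrix.of fun i => ![b i, R i 0, R i 1]
  have hLB : L * B = !![0, 1, 0; 0, 0, 1] := by
    have e : ∀ k l, (L * R) k l = (1 : Matrix (Fin 2) (Fin 2) ℂ) k l := fun k l => by rw [hR]
    have e0 : ∀ k, (L *ᵥ b) k = 0 := fun k => by rw [hLb]; rfl
    simp only [Matrix.mul_apply, mulVec, dotProduct, Fin.sum_univ_three] at e e0
    ext k j
    fin_cases k <;> fin_cases j <;>
      simp [Matrix.mul_apply, Fin.sum_univ_three, B, e, e0]
  refine ⟨B, ?_, rfl, ?_⟩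
  · rw [isUnit_iff_ne_zero]
    intro hdet
    obtain ⟨c, hc, hBc⟩ := exists_mulVec_eq_zero_iff.mpr hdet
    have h1 : (L * B) *ᵥ c = 0 := by rw [← mulVec_mulVec, hBc, mulVec_zero]
    rw [hLB] at h1
    have h2 := congrFun h1 0
    have h3 := congrFun h1 1
    simp [mulVec, dotProduct, Fin.sum_univ_three] at h2 h3
    have h4 : ∀ i, b i * c 0 = 0 := by
      intro i
      have := congrFun hBc i
      simpa [mulVec, dotProduct, Fin.sum_univ_three, B, h2, h3] using this
    have h5 : c 0 ≠ 0 := by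
      intro h5
      apply hc
      ext i
      fin_cases i <;> simp [h2, h3, h5]
    exact hb (funext fun i => (mul_eq_zero.mp (h4 i)).resolve_right h5)
  · have : Bᴴ * G * B = (L * B)ᴴ * (L * B) := by
      rw [hL, conjTranspose_mul]
      simp only [Matrix.mul_assoc]
    rw [this, hLB]
    ext i j
    fin_cases i <;> fin_cases j <;>
      simp [Matrix.mul_apply, Fin.sum_univ_two, conjTranspose_apply, diagonal]

theorem rank_pt_of_blk_rank {ρ : Matrix (Fin 3 × Fin 3) (Fin 3 × Fin 3) ℂ} (hρ : PPT ρ)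
    (hr : ρ.rank = 4) {a b : Fin 3 → ℂ} (ha : a ≠ 0) (hb : b ≠ 0) (h0 : ρ *ᵥ prodVec a b = 0)
    (hra : (blk ρ a a).rank = 2) (hrb : (blk (swap ρ) b b).rank = 2) : (pt ρ).rank = 4 := by
  have hk : ∀ {ρ : Matrix (Fin 3 × Fin 3) (Fin 3 × Fin 3) ℂ} {a b : Fin 3 → ℂ},
      ρ *ᵥ prodVec a b = 0 → blk ρ a a *ᵥ b = 0 := by
    intro ρ a b h
    ext j
    rw [mulVec_prodVec, h]
    simp
  obtain ⟨B, hB, hB0, hBG⟩ := exists_normalizing (blk_posSemidef hρ.1 a) hb (hk h0) hra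
  obtain ⟨A, hA, hA0, hAG⟩ := exists_normalizing (blk_posSemidef hρ.swap.1 b) ha
    (hk (swap_mulVec _ _ _ h0)) hrb
  rw [← rank_pt_loc hA hB]
  refine rank_pt_of_normal_form (hρ.loc A B) (by rw [rank_loc hA hB, hr]) ?_ ?_ ?_
  · rw [loc_eq_blk, hA0, hBG]
    simp
  · intro α β hα hβ
    rw [loc_eq_blk, hA0, hBG]
    fin_cases α <;> fin_cases β <;> simp_all [diagonal]
  · intro α β hα hβ
    rw [loc_swap, loc_eq_blk, hB0, hAG]
    fin_cases α <;> fin_cases β <;> simp_all [diagonal]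

/-- A symmetric pair of commuting operators has a joint orthonormal eigenbasis. -/
theorem exists_joint_eigenbasis {E : Type*} [NormedAddCommGroup E] [InnerProductSpace ℂ E]
    [FiniteDimensional ℂ E] {n : ℕ} (hn : Module.finrank ℂ E = n) {S T : E →ₗ[ℂ] E}
    (hS : S.IsSymmetric) (hT : T.IsSymmetric) (h : Commute S T) :
    ∃ (b : OrthonormalBasis (Fin n) ℂ E) (c d : Fin n → ℂ),
      ∀ t, S (b t) = c t • b t ∧ T (b t) = d t • b t := by
  classical
  have hV := hS.directSum_isInternal_of_commute hT h
  have hO := hS.orthogonalFamily_eigenspace_inf_eigenspace hT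
  set V : ℂ × ℂ → Submodule ℂ E :=
    fun i => Module.End.eigenspace S i.2 ⊓ Module.End.eigenspace T i.1
  have hV' : DirectSum.IsInternal fun i : {i // V i ≠ ⊥} => V i :=
    DirectSum.isInternal_ne_bot_iff.mpr hV
  have hO' : OrthogonalFamily ℂ (fun i : {i // V i ≠ ⊥} => V i) fun i => (V i).subtypeₗᵢ :=
    hO.comp Subtype.val_injective
  let _ : Fintype {i // V i ≠ ⊥} :=
    iSupIndep.fintypeNeBotOfFiniteDimensional hV.submodule_iSupIndep
  refine ⟨hV'.subordinateOrthonormalBasis hn hO',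
    fun t => (hV'.subordinateOrthonormalBasisIndex hn t hO').1.2,
    fun t => (hV'.subordinateOrthonormalBasisIndex hn t hO').1.1, fun t => ?_⟩
  have := hV'.subordinateOrthonormalBasis_subordinate hn t hO'
  exact ⟨Module.End.mem_eigenspace_iff.mp this.1, Module.End.mem_eigenspace_iff.mp this.2⟩

/-- Unitary diagonalization of normal matrices. -/
theorem exists_unitary_diagonal {n : ℕ} {A : Matrix (Fin n) (Fin n) ℂ} (hA : A * Aᴴ = Aᴴ * A) :
    ∃ (U : Matrix (Fin n) (Fin n) ℂ) (d : Fin n → ℂ), U * Uᴴ = 1 ∧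
      A = U * diagonal d * Uᴴ := by
  have hS : (toEuclideanLin (A + Aᴴ)).IsSymmetric := by
    rw [isSymmetric_toEuclideanLin_iff]
    simp [IsHermitian, add_comm]
  have hT : (toEuclideanLin (Complex.I • (A - Aᴴ))).IsSymmetric := by
    rw [isSymmetric_toEuclideanLin_iff]
    simp only [IsHermitian, conjTranspose_smul, conjTranspose_sub, conjTranspose_conjTranspose,
      RCLike.star_def, Complex.conj_I, neg_smul, smul_sub]
    abel
  have hc : Commute (toEuclideanLin (A + Aᴴ)) (toEuclideanLin (Complex.I • (A - Aᴴ))) := by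
    have : (A + Aᴴ) * (Complex.I • (A - Aᴴ)) = (Complex.I • (A - Aᴴ)) * (A + Aᴴ) := by
      rw [Matrix.mul_smul, Matrix.smul_mul]
      congr 1
      simp only [mul_add, add_mul, mul_sub, sub_mul, hA]
      abel
    rw [commute_iff_eq, Module.End.mul_eq_comp, Module.End.mul_eq_comp, ← toLpLin_mul_same, this,
      toLpLin_mul_same]
  obtain ⟨b, c, d, hb⟩ := exists_joint_eigenbasis (n := n) (by simp) hS hT hc
  set U : Matrix (Fin n) (Fin n) ℂ := of fun i t => b t i with hUdef
  have hU : U * Uᴴ = 1 := by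
    ext i j
    have := b.sum_inner_mul_inner (EuclideanSpace.single i 1) (EuclideanSpace.single j 1)
    simpa [hUdef, Matrix.mul_apply, Matrix.one_apply, EuclideanSpace.inner_single_left,
      EuclideanSpace.inner_single_right, eq_comm] using this
  refine ⟨U, fun t => (c t - Complex.I * d t) / 2, hU, ?_⟩
  have key : A * U = U * diagonal fun t => (c t - Complex.I * d t) / 2 := by
    ext i t
    have h1 := congrArg (fun x : EuclideanSpace ℂ (Fin n) => x i) (hb t).1
    have h2 := congrArg (fun x : EuclideanSpace ℂ (Fin n) => x i) (hb t).2
    simp only [toLpLin_apply, add_mulVec, sub_mulVec, smul_mulVec, Pi.add_apply, Pi.sub_apply,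
      Pi.smul_apply, smul_eq_mul, PiLp.smul_apply] at h1 h2
    rw [mul_diagonal]
    change (A *ᵥ (b t).ofLp) i = b t i * _
    linear_combination (1 / 2) * h1 - (Complex.I / 2) * h2 +
      (1 / 2) * ((A *ᵥ (b t).ofLp) i - (Aᴴ *ᵥ (b t).ofLp) i) * Complex.I_mul_I
  rw [← key, Matrix.mul_assoc, hU, Matrix.mul_one]

/-- The state on `ℂ² ⊗ ℂᵏ` built from a normal matrix is separable. -/
theorem separable_of_normal {n : ℕ} {A : Matrix (Fin n) (Fin n) ℂ} (hA : A * Aᴴ = Aᴴ * A)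
    {M : Matrix (Fin 2 × Fin n) (Fin 2 × Fin n) ℂ}
    (h00 : ∀ j l, M (0, j) (0, l) = (1 : Matrix (Fin n) (Fin n) ℂ) j l)
    (h01 : ∀ j l, M (0, j) (1, l) = A j l) (h10 : ∀ j l, M (1, j) (0, l) = Aᴴ j l)
    (h11 : ∀ j l, M (1, j) (1, l) = (Aᴴ * A) j l) : Separable M := by
  obtain ⟨U, d, hU, hd⟩ := exists_unitary_diagonal hA
  have hU' : Uᴴ * U = 1 := mul_eq_one_comm.mp hU
  have hA1 : Aᴴ = U * diagonal (star d) * Uᴴ := by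
    simp [hd, Matrix.mul_assoc, diagonal_conjTranspose]
  have hA2 : Aᴴ * A = U * diagonal (star d * d) * Uᴴ := by
    rw [hA1, hd]
    calc _ = U * diagonal (star d) * (Uᴴ * U) * diagonal d * Uᴴ := by simp only [Matrix.mul_assoc]
      _ = _ := by
        rw [hU', Matrix.mul_one, Matrix.mul_assoc U, diagonal_mul_diagonal]
        rfl
  refine separable_iff.mpr ⟨n, fun t => ![1, conj (d t)], fun t j => U j t, fun i j k l => ?_⟩
  have key : ∀ e : Fin n → ℂ, (U * diagonal e * Uᴴ) j l = ∑ t, e t * (U j t * conj (U l t)) := by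
    intro e
    rw [Matrix.mul_apply]
    simp only [Matrix.mul_diagonal, conjTranspose_apply, RCLike.star_def]
    exact Finset.sum_congr rfl fun t _ => by ring
  fin_cases i <;> fin_cases k
  · have := key 1
    rw [Pi.one_def, diagonal_one, Matrix.mul_one, hU] at this
    simpa [h00] using this
  · simp only [Fin.zero_eta, Fin.mk_one, h01]
    rw [hd, key]
    refine Finset.sum_congr rfl fun t _ => ?_
    simp; ring
  · simp only [Fin.zero_eta, Fin.mk_one, h10]
    rw [hA1, key]
    refine Finset.sum_congr rfl fun t _ => ?_
    simp; ring
  · simp only [Fin.mk_one, h11]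
    rw [hA2, key]
    refine Finset.sum_congr rfl fun t _ => ?_
    simp; ring

theorem eq_zero_of_mul_conj_add_eq_zero {a b : ℂ} (h : a * conj a + b * conj b = 0) :
    a = 0 ∧ b = 0 := by
  rw [Complex.mul_conj, Complex.mul_conj, ← Complex.ofReal_add, Complex.ofReal_eq_zero] at h
  have h1 := Complex.normSq_nonneg a
  have h2 := Complex.normSq_nonneg b
  exact ⟨Complex.normSq_eq_zero.mp (by linarith), Complex.normSq_eq_zero.mp (by linarith)⟩

theorem mul_conj_eq_of_pairing {x₀ x₁ v₀ v₁ p₀ p₁ q₀ q₁ : ℂ} (hd : x₀ * v₁ - x₁ * v₀ ≠ 0)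
    (hn : x₀ * conj x₀ + x₁ * conj x₁ = v₀ * conj v₀ + v₁ * conj v₁)
    (hpq : p₀ * conj p₀ + p₁ * conj p₁ = q₀ * conj q₀ + q₁ * conj q₁)
    (h : (conj q₀ * x₀ + conj q₁ * x₁) * (conj x₀ * p₀ + conj x₁ * p₁) =
      (conj q₀ * v₀ + conj q₁ * v₁) * (conj v₀ * p₀ + conj v₁ * p₁)) :
    (conj x₀ * p₀ + conj x₁ * p₁) * conj (conj x₀ * p₀ + conj x₁ * p₁) =
      (conj v₀ * q₀ + conj v₁ * q₁) * conj (conj v₀ * q₀ + conj v₁ * q₁) := by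
  have hgram : ∀ r₀ r₁ : ℂ, (x₀ * v₁ - x₁ * v₀) * conj (x₀ * v₁ - x₁ * v₀) *
      (r₀ * conj r₀ + r₁ * conj r₁) =
      (v₀ * conj v₀ + v₁ * conj v₁) * ((conj x₀ * r₀ + conj x₁ * r₁) *
        conj (conj x₀ * r₀ + conj x₁ * r₁)) + (x₀ * conj x₀ + x₁ * conj x₁) *
        ((conj v₀ * r₀ + conj v₁ * r₁) * conj (conj v₀ * r₀ + conj v₁ * r₁))
      - (x₀ * conj v₀ + x₁ * conj v₁) * ((conj x₀ * r₀ + conj x₁ * r₁) *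
        conj (conj v₀ * r₀ + conj v₁ * r₁))
      - (v₀ * conj x₀ + v₁ * conj x₁) * ((conj v₀ * r₀ + conj v₁ * r₁) *
        conj (conj x₀ * r₀ + conj x₁ * r₁)) := by
    intro r₀ r₁
    simp only [map_add, map_sub, map_mul, Complex.conj_conj]
    ring
  have hgp := hgram p₀ p₁
  have hgq := hgram q₀ q₁
  rw [← hpq] at hgq
  have hh : conj (conj x₀ * q₀ + conj x₁ * q₁) * (conj x₀ * p₀ + conj x₁ * p₁) =
      conj (conj v₀ * q₀ + conj v₁ * q₁) * (conj v₀ * p₀ + conj v₁ * p₁) := by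
    simp only [map_add, map_mul, Complex.conj_conj]
    linear_combination h
  have hz : p₀ * conj p₀ + p₁ * conj p₁ = 0 →
      (conj x₀ * p₀ + conj x₁ * p₁) * conj (conj x₀ * p₀ + conj x₁ * p₁) =
      (conj v₀ * q₀ + conj v₁ * q₁) * conj (conj v₀ * q₀ + conj v₁ * q₁) := by
    intro hp
    obtain ⟨rfl, rfl⟩ := eq_zero_of_mul_conj_add_eq_zero hp
    obtain ⟨rfl, rfl⟩ := eq_zero_of_mul_conj_add_eq_zero (hpq.symm.trans hp)
    simp
  clear hgram h
  have hd2 : (x₀ * v₁ - x₁ * v₀) * conj (x₀ * v₁ - x₁ * v₀) ≠ 0 :=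
    mul_ne_zero hd ((map_ne_zero _).mpr hd)
  generalize (x₀ * v₁ - x₁ * v₀) * conj (x₀ * v₁ - x₁ * v₀) = D at *
  generalize conj x₀ * p₀ + conj x₁ * p₁ = a at *
  generalize conj v₀ * p₀ + conj v₁ * p₁ = b at *
  generalize conj x₀ * q₀ + conj x₁ * q₁ = c at *
  generalize conj v₀ * q₀ + conj v₁ * q₁ = d at *
  rw [← hn] at hgp hgq
  generalize x₀ * conj x₀ + x₁ * conj x₁ = n at *
  generalize x₀ * conj v₀ + x₁ * conj v₁ = g at *
  generalize v₀ * conj x₀ + v₁ * conj x₁ = g' at *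
  obtain ⟨s, hs, hs'⟩ | hcd : (∃ s, a = s * conj d ∧ b = s * conj c) ∨ (c = 0 ∧ d = 0) := by
    by_cases hc : c = 0
    · by_cases hd : d = 0
      · exact .inr ⟨hc, hd⟩
      · have hd' : conj d ≠ 0 := (map_ne_zero _).mpr hd
        refine .inl ⟨a / conj d, by field_simp, ?_⟩
        field_simp
        linear_combination -hh
    · have hc' : conj c ≠ 0 := (map_ne_zero _).mpr hc
      refine .inl ⟨b / conj c, ?_, by field_simp⟩
      field_simp
      linear_combination hh
  · rw [hs, hs'] at hgp
    simp only [map_mul, Complex.conj_conj] at hgp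
    have h1 : D * (p₀ * conj p₀ + p₁ * conj p₁) * (s * conj s - 1) = 0 := by
      linear_combination (s * conj s) * hgq - hgp
    rcases mul_eq_zero.mp h1 with h1 | h1
    · exact hz ((mul_eq_zero.mp h1).resolve_left hd2)
    · rw [hs]
      simp only [map_mul, Complex.conj_conj]
      linear_combination (d * conj d) * h1
  · refine hz ((mul_eq_zero.mp ?_).resolve_left hd2)
    rw [hgq, hcd.1, hcd.2]; simp

theorem exists_unit_mul_conj_eq {a d : ℂ} (h : a * conj a = d * conj d) :
    ∃ ω : ℂ, ω * conj ω = 1 ∧ ω * conj a = conj d := by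
  by_cases ha : a = 0
  · have hd : d = 0 := by simpa [ha] using h.symm
    exact ⟨1, by simp, by simp [ha, hd]⟩
  · have ha' : conj a ≠ 0 := (map_ne_zero _).mpr ha
    refine ⟨conj d / conj a, ?_, by field_simp⟩
    rw [map_div₀, Complex.conj_conj, Complex.conj_conj]
    field_simp
    linear_combination -h

/-- Solving for the corner of the normal completion. -/
theorem exists_corner {x₀ x₁ v₀ v₁ w₀ w₁ : ℂ} (hd : x₀ * v₁ - x₁ * v₀ ≠ 0)
    (hn : x₀ * conj x₀ + x₁ * conj x₁ = v₀ * conj v₀ + v₁ * conj v₁)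
    (h : conj x₀ * w₀ + conj x₁ * w₁ + conj (conj v₀ * w₀ + conj v₁ * w₁) = 0) :
    ∃ z : ℂ, w₀ = conj z * x₀ - z * v₀ ∧ w₁ = conj z * x₁ - z * v₁ := by
  obtain ⟨α, β, rfl, rfl⟩ : ∃ α β, w₀ = α * x₀ + β * v₀ ∧ w₁ = α * x₁ + β * v₁ := by
    refine ⟨(w₀ * v₁ - w₁ * v₀) / (x₀ * v₁ - x₁ * v₀),
      (x₀ * w₁ - x₁ * w₀) / (x₀ * v₁ - x₁ * v₀), ?_, ?_⟩ <;>
    · rw [div_mul_eq_mul_div, div_mul_eq_mul_div, ← add_div, eq_div_iff hd]; ring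
  suffices α + conj β = 0 by
    refine ⟨conj α, ?_, ?_⟩
    · have : β = - conj α := by
        have := congrArg conj this
        simp only [map_add, Complex.conj_conj, map_zero] at this
        linear_combination this
      rw [this, Complex.conj_conj]; ring
    · have : β = - conj α := by
        have := congrArg conj this
        simp only [map_add, Complex.conj_conj, map_zero] at this
        linear_combination this
      rw [this, Complex.conj_conj]; ring
  have hd2 : (x₀ * v₁ - x₁ * v₀) * conj (x₀ * v₁ - x₁ * v₀) ≠ 0 :=
    mul_ne_zero hd ((map_ne_zero _).mpr hd)
  have h' := congrArg conj h
  refine (mul_eq_zero.mp (?_ : (x₀ * v₁ - x₁ * v₀) * conj (x₀ * v₁ - x₁ * v₀) * _ = 0)).resolve_left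
    hd2
  simp only [map_add, map_sub, map_mul, Complex.conj_conj, map_zero] at h h' ⊢
  have e1 : (x₀ * conj x₀ + x₁ * conj x₁) * (α + conj β) +
      (conj x₀ * v₀ + conj x₁ * v₁) * (conj α + β) = 0 := by
    linear_combination h + (conj β) * hn
  have e2 : (x₀ * conj x₀ + x₁ * conj x₁) * (conj α + β) +
      (x₀ * conj v₀ + x₁ * conj v₁) * (α + conj β) = 0 := by
    linear_combination h' + β * hn
  linear_combination (x₀ * conj x₀ + x₁ * conj x₁) * e1 - (conj x₀ * v₀ + conj x₁ * v₁) * e2 - (x₀ * conj x₀ + x₁ * conj x₁) * (α + conj β) * hn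

/-- Completion of a `3 × 3` matrix to a normal `4 × 4` matrix, in adapted coordinates. -/
theorem exists_normal_completion_aux {A : Matrix (Fin 3) (Fin 3) ℂ} {X v : Fin 3 → ℂ}
    (h : Aᴴ * A + vecMulVec v (star v) = A * Aᴴ + vecMulVec X (star X))
    (hX : X 2 = 0) (hv : v 2 = 0) :
    Aᴴ * A = A * Aᴴ ∨ ∃ ω z : ℂ, ω * conj ω = 1 ∧
      Aᴴ *ᵥ (ω • X) + z • v = A *ᵥ v + conj z • (ω • X) := by
  have E : ∀ j l, ∑ i, conj (A i j) * A i l + v j * conj (v l) =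
      ∑ i, A j i * conj (A l i) + X j * conj (X l) := by
    intro j l
    simpa [Matrix.mul_apply, vecMulVec_apply] using congrFun (congrFun h j) l
  simp only [Fin.sum_univ_three] at E
  have hn : X 0 * conj (X 0) + X 1 * conj (X 1) = v 0 * conj (v 0) + v 1 * conj (v 1) := by
    have h0 := E 0 0
    have h1 := E 1 1
    have h2 := E 2 2
    rw [hX, hv] at h2
    linear_combination - h0 - h1 - h2
  by_cases hd : X 0 * v 1 - X 1 * v 0 = 0
  · left
    have e : (X 0 * conj (X 0) - v 0 * conj (v 0)) * conj (X 0 * conj (X 0) - v 0 * conj (v 0)) +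
        (X 0 * conj (X 1) - v 0 * conj (v 1)) * conj (X 0 * conj (X 1) - v 0 * conj (v 1)) = 0 := by
      simp only [map_sub, map_mul, Complex.conj_conj]
      have hd' := congrArg conj hd
      simp only [map_sub, map_mul, map_zero] at hd'
      linear_combination (X 0 * conj (X 0) - v 0 * conj (v 0)) * hn +
        (X 0 * v 1 - X 1 * v 0) * hd'
    obtain ⟨e0, e1⟩ := eq_zero_of_mul_conj_add_eq_zero e
    have e1' := congrArg conj e1
    simp only [map_sub, map_mul, Complex.conj_conj, map_zero] at e1'
    have hvX : vecMulVec v (star v) = vecMulVec X (star X) := by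
      ext j l
      fin_cases j <;> fin_cases l <;> simp [vecMulVec_apply, hX, hv]
      · linear_combination -e0
      · linear_combination -e1
      · linear_combination -e1'
      · linear_combination e0 - hn
    rw [hvX] at h
    exact add_right_cancel h
  · right
    have e00 := E 0 0
    have e01 := E 0 1
    have e02 := E 0 2
    have e10 := E 1 0
    have e11 := E 1 1
    have e12 := E 1 2
    have e20 := E 2 0
    have e21 := E 2 1
    have e22 := E 2 2
    simp only [hX, hv, map_zero, mul_zero, zero_mul, add_zero] at e02 e12 e20 e21 e22
    have hpq : A 0 2 * conj (A 0 2) + A 1 2 * conj (A 1 2) =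
        conj (A 2 0) * conj (conj (A 2 0)) + conj (A 2 1) * conj (conj (A 2 1)) := by
      have h2 := E 2 2
      rw [hX, hv] at h2
      simp only [Complex.conj_conj]
      linear_combination h2
    have hK : (conj (conj (A 2 0)) * X 0 + conj (conj (A 2 1)) * X 1) *
        (conj (X 0) * A 0 2 + conj (X 1) * A 1 2) =
        (conj (conj (A 2 0)) * v 0 + conj (conj (A 2 1)) * v 1) *
        (conj (v 0) * A 0 2 + conj (v 1) * A 1 2) := by
      simp only [Complex.conj_conj]
      linear_combination - (A 0 0 * A 0 0 + A 0 1 * A 1 0 + A 0 2 * A 2 0 - (A 0 0 + A 1 1) * A 0 0 + (A 0 0 * A 1 1 - A 0 1 * A 1 0)) * e00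
        - (A 1 0 * A 0 0 + A 1 1 * A 1 0 + A 1 2 * A 2 0 - (A 0 0 + A 1 1) * A 1 0) * e01
        - (A 2 0 * A 0 0 + A 2 1 * A 1 0 + A 2 2 * A 2 0 - (A 0 0 + A 1 1) * A 2 0) * e02
        - (A 0 0 * A 0 1 + A 0 1 * A 1 1 + A 0 2 * A 2 1 - (A 0 0 + A 1 1) * A 0 1) * e10
        - (A 1 0 * A 0 1 + A 1 1 * A 1 1 + A 1 2 * A 2 1 - (A 0 0 + A 1 1) * A 1 1 + (A 0 0 * A 1 1 - A 0 1 * A 1 0)) * e11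
        - (A 2 0 * A 0 1 + A 2 1 * A 1 1 + A 2 2 * A 2 1 - (A 0 0 + A 1 1) * A 2 1) * e12
        - (A 0 0 * A 0 2 + A 0 1 * A 1 2 + A 0 2 * A 2 2 - (A 0 0 + A 1 1) * A 0 2) * e20
        - (A 1 0 * A 0 2 + A 1 1 * A 1 2 + A 1 2 * A 2 2 - (A 0 0 + A 1 1) * A 1 2) * e21
        - (A 2 0 * A 0 2 + A 2 1 * A 1 2 + A 2 2 * A 2 2 - (A 0 0 + A 1 1) * A 2 2 + (A 0 0 * A 1 1 - A 0 1 * A 1 0)) * e22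
    have hT : conj (X 0) * (A 0 0 * X 0 + A 0 1 * X 1) + conj (X 1) * (A 1 0 * X 0 + A 1 1 * X 1) =
        conj (v 0) * (A 0 0 * v 0 + A 0 1 * v 1) + conj (v 1) * (A 1 0 * v 0 + A 1 1 * v 1) := by
      linear_combination - A 0 0 * e00 - A 1 0 * e01 - A 2 0 * e02
        - A 0 1 * e10 - A 1 1 * e11 - A 2 1 * e12
        - A 0 2 * e20 - A 1 2 * e21 - A 2 2 * e22
    obtain ⟨ω, hω, hω'⟩ := exists_unit_mul_conj_eq (mul_conj_eq_of_pairing hd hn hpq hK)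
    have hT' := congrArg conj hT
    simp only [map_add, map_mul, Complex.conj_conj] at hω' hT'
    obtain ⟨z, hz0, hz1⟩ := exists_corner (x₀ := ω * X 0) (x₁ := ω * X 1) (v₀ := v 0) (v₁ := v 1)
      (w₀ := conj (A 0 0) * (ω * X 0) + conj (A 1 0) * (ω * X 1) - A 0 0 * v 0 - A 0 1 * v 1)
      (w₁ := conj (A 0 1) * (ω * X 0) + conj (A 1 1) * (ω * X 1) - A 1 0 * v 0 - A 1 1 * v 1)
      (by
        have : ω ≠ 0 := by rintro rfl; simp at hω
        have := mul_ne_zero this hd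
        intro h0; apply this; linear_combination h0)
      (by
        simp only [map_mul]
        linear_combination hn + (X 0 * conj (X 0) + X 1 * conj (X 1)) * hω)
      (by
        simp only [map_add, map_sub, map_mul, Complex.conj_conj]
        linear_combination hT' + (conj (X 0) * (conj (A 0 0) * X 0 + conj (A 1 0) * X 1) +
          conj (X 1) * (conj (A 0 1) * X 0 + conj (A 1 1) * X 1)) * hω)
    refine ⟨ω, z, hω, ?_⟩
    ext i
    fin_cases i <;> simp [Matrix.mulVec, dotProduct, Fin.sum_univ_three, hX, hv]
    · linear_combination hz0
    · linear_combination hz1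
    · linear_combination hω'

/-- A nonzero vector can be rescaled to a column of a unitary matrix. -/
theorem exists_unitary_col {n : ℕ} (i₀ : Fin n) {y : Fin n → ℂ} (hy : y ≠ 0) :
    ∃ (U : Matrix (Fin n) (Fin n) ℂ) (c : ℂ), Uᴴ * U = 1 ∧ ∀ i, U i i₀ = c * y i := by
  have hy' : WithLp.toLp 2 y ≠ 0 := by simpa using hy
  let w : Fin n → EuclideanSpace ℂ (Fin n) := fun _ => ((‖WithLp.toLp 2 y‖ : ℂ)⁻¹) • WithLp.toLp 2 y
  have hw : Orthonormal ℂ (({i₀} : Set (Fin n)).domRestrict w) := by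
    rw [orthonormal_iff_ite]
    rintro ⟨i, hi⟩ ⟨j, hj⟩
    obtain rfl := hi
    obtain rfl := hj
    change inner ℂ (w j) (w j) = _
    simp [w, inner_self_eq_norm_sq_to_K, norm_smul, hy']
  obtain ⟨b, hb⟩ := hw.exists_orthonormalBasis_extension_of_card_eq (by simp)
  refine ⟨of fun i t => b t i, (‖WithLp.toLp 2 y‖ : ℂ)⁻¹, ?_, fun i => ?_⟩
  · ext s t
    have := orthonormal_iff_ite.mp b.orthonormal s t
    simpa [Matrix.mul_apply, Matrix.one_apply, PiLp.inner_apply, mul_comm] using this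
  · simp [hb i₀ rfl, w]

/-- Completion of a `3 × 3` matrix to a normal `4 × 4` matrix. -/
theorem exists_normal_completion {A : Matrix (Fin 3) (Fin 3) ℂ} {X v : Fin 3 → ℂ}
    (h : Aᴴ * A + vecMulVec v (star v) = A * Aᴴ + vecMulVec X (star X)) :
    Aᴴ * A = A * Aᴴ ∨ ∃ ω z : ℂ, ω * conj ω = 1 ∧
      Aᴴ *ᵥ (ω • X) + z • v = A *ᵥ v + conj z • (ω • X) := by
  obtain ⟨y, hy, hy0⟩ : ∃ y, y ≠ 0 ∧ (of ![star X, star v, 0] : Matrix (Fin 3) (Fin 3) ℂ) *ᵥ y = 0 :=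
    exists_mulVec_eq_zero_iff.mpr (by simp [det_fin_three])
  obtain ⟨U, c, hU, hc⟩ := exists_unitary_col (2 : Fin 3) hy
  have hU' : U * Uᴴ = 1 := mul_eq_one_comm.mp hU
  have hperp : ∀ x, star x ⬝ᵥ y = 0 → (Uᴴ *ᵥ x) 2 = 0 := by
    intro x hx
    have := congrArg conj hx
    simp only [mulVec, dotProduct, conjTranspose_apply, hc, map_sum, map_mul, Pi.star_apply,
      RCLike.star_def, Complex.conj_conj, map_zero] at this ⊢
    calc _ = conj c * ∑ x_1, x x_1 * conj (y x_1) := by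
          rw [Finset.mul_sum]
          exact Finset.sum_congr rfl fun _ _ => by ring
      _ = 0 := by rw [this, mul_zero]
  have hvec : ∀ x, vecMulVec (Uᴴ *ᵥ x) (star (Uᴴ *ᵥ x)) = Uᴴ * vecMulVec x (star x) * U := by
    intro x
    rw [star_mulVec, conjTranspose_conjTranspose, ← mul_vecMulVec, ← vecMulVec_mul, Matrix.mul_assoc]
  have hconj : ∀ M N : Matrix (Fin 3) (Fin 3) ℂ, Uᴴ * M * U * (Uᴴ * N * U) = Uᴴ * (M * N) * U := by
    intro M N
    calc _ = Uᴴ * M * (U * Uᴴ) * N * U := by simp only [Matrix.mul_assoc]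
      _ = _ := by rw [hU', Matrix.mul_one]; simp only [Matrix.mul_assoc]
  have hH : (Uᴴ * A * U)ᴴ = Uᴴ * Aᴴ * U := by simp [Matrix.mul_assoc]
  have hcancel : ∀ {M N : Matrix (Fin 3) (Fin 3) ℂ}, Uᴴ * M * U = Uᴴ * N * U → M = N := by
    intro M N hMN
    have := congrArg (fun P => U * P * Uᴴ) hMN
    simpa [Matrix.mul_assoc, hU', ← Matrix.mul_assoc U Uᴴ] using this
  rcases exists_normal_completion_aux (A := Uᴴ * A * U) (X := Uᴴ *ᵥ X) (v := Uᴴ *ᵥ v)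
    (by rw [hH, hconj, hconj, hvec, hvec, ← add_mul, ← add_mul, ← mul_add, ← mul_add, h])
    (hperp X (congrFun hy0 0)) (hperp v (congrFun hy0 1)) with h1 | ⟨ω, z, hω, hz⟩
  · left
    rw [hH, hconj, hconj] at h1
    exact hcancel h1
  · refine .inr ⟨ω, z, hω, ?_⟩
    have := congrArg (U *ᵥ ·) hz
    simpa [hH, mulVec_add, mulVec_smul, mulVec_mulVec, Matrix.mul_assoc, hU',
      ← Matrix.mul_assoc U Uᴴ] using this

theorem separable_submatrix {n m m' : ℕ} {ρ : Matrix (Fin n × Fin m) (Fin n × Fin m) ℂ}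
    (h : Separable ρ) (f : Fin m' → Fin m) :
    Separable (ρ.submatrix (Prod.map id f) (Prod.map id f)) := by
  obtain ⟨k, φ, ψ, h⟩ := separable_iff.mp h
  exact separable_iff.mpr ⟨k, φ, fun t j => ψ t (f j), fun i j k' l => by simp [h]⟩

theorem exists_vecMulVec_of_rank_le_one {n : Type*} [Fintype n] [DecidableEq n]
    {P : Matrix n n ℂ} (hP : P.PosSemidef) (h : P.rank ≤ 1) : ∃ v, P = vecMulVec v (star v) := by
  obtain ⟨C, hC⟩ := exists_factorization hP
  rcases Nat.le_one_iff_eq_zero_or_eq_one.mp h with h | h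
  · exact ⟨0, by rw [eq_zero_of_rank_eq_zero h]; simp⟩
  · generalize P.rank = r at C hC h
    subst h
    exact ⟨fun j => conj (C 0 j), by ext; simp [hC, Matrix.mul_apply, vecMulVec_apply]⟩

/-- The Schur complement of a bipartite matrix on `ℂ² ⊗ ℂⁿ` with identity corner. -/
theorem schur_two {n : ℕ} {M : Matrix (Fin 2 × Fin n) (Fin 2 × Fin n) ℂ} (hM : M.PosSemidef)
    (h00 : ∀ j l, M (0, j) (0, l) = (1 : Matrix (Fin n) (Fin n) ℂ) j l)
    {A D : Matrix (Fin n) (Fin n) ℂ} (hA : ∀ j l, M (0, j) (1, l) = A j l)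
    (hD : ∀ j l, M (1, j) (1, l) = D j l) :
    (D - Aᴴ * A).PosSemidef ∧ M.rank = n + (D - Aᴴ * A).rank := by
  let e : Fin n ⊕ Fin n ≃ Fin 2 × Fin n := Equiv.ofBijective
    (Sum.elim (fun j => ((0 : Fin 2), j)) (fun j => ((1 : Fin 2), j))) <| by
      constructor
      · rintro (x | x) (y | y) h <;> simp_all
      · rintro ⟨i, j⟩
        fin_cases i
        · exact ⟨.inl j, rfl⟩
        · exact ⟨.inr j, rfl⟩
  have h1 : (M.submatrix e e).toBlocks₁₁ = 1 := by ext j l; exact h00 j l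
  have h2 : (M.submatrix e e).toBlocks₁₂ = A := by ext j l; exact hA j l
  have h3 : (M.submatrix e e).toBlocks₂₂ = D := by ext j l; exact hD j l
  have := schur_one (hM.submatrix e) h1
  rwa [h2, h3, rank_submatrix, Fintype.card_fin] at this

theorem separable_of_normal_completion {A : Matrix (Fin 3) (Fin 3) ℂ} {X v : Fin 3 → ℂ} {z : ℂ}
    (h : Aᴴ * A + vecMulVec v (star v) = A * Aᴴ + vecMulVec X (star X))
    (hz : Aᴴ *ᵥ X + z • v = A *ᵥ v + conj z • X)
    {M : Matrix (Fin 2 × Fin 3) (Fin 2 × Fin 3) ℂ}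
    (h00 : ∀ j l, M (0, j) (0, l) = (1 : Matrix (Fin 3) (Fin 3) ℂ) j l)
    (h01 : ∀ j l, M (0, j) (1, l) = A j l) (h10 : ∀ j l, M (1, j) (0, l) = Aᴴ j l)
    (h11 : ∀ j l, M (1, j) (1, l) = (Aᴴ * A + vecMulVec v (star v)) j l) : Separable M := by
  let e : Fin 3 ⊕ Fin 1 ≃ Fin 4 := finSumFinEquiv
  let N₀ : Matrix (Fin 3 ⊕ Fin 1) (Fin 3 ⊕ Fin 1) ℂ :=
    fromBlocks A (replicateCol (Fin 1) X) (replicateRow (Fin 1) (star v)) (of fun _ _ => z)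
  have hN₀ : N₀ * N₀ᴴ = N₀ᴴ * N₀ := by
    simp only [N₀, fromBlocks_conjTranspose, fromBlocks_multiply]
    congr 1
    · ext j l
      have := congrFun (congrFun h j) l
      simp [Matrix.mul_apply, vecMulVec_apply] at this ⊢
      linear_combination -this
    · ext j l
      have := congrFun hz j
      simp [Matrix.mul_apply, mulVec, dotProduct] at this ⊢
      linear_combination -this
    · ext j l
      have := congrArg conj (congrFun hz l)
      simp [Matrix.mul_apply, mulVec, dotProduct] at this ⊢
      simp only [Fin.sum_univ_three] at this ⊢
      linear_combination -this
    · ext j l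
      have := congrArg trace h
      rw [trace_add, trace_add, trace_mul_comm, add_right_inj] at this
      simp [Matrix.mul_apply, trace, vecMulVec_apply] at this ⊢
      simp only [mul_comm, Fin.sum_univ_three] at this ⊢
      linear_combination this
  let N : Matrix (Fin 4) (Fin 4) ℂ := N₀.submatrix e.symm e.symm
  have hN : N * Nᴴ = Nᴴ * N := by
    simp only [N, conjTranspose_submatrix, submatrix_mul_equiv, hN₀]
  let M' : Matrix (Fin 2 × Fin 4) (Fin 2 × Fin 4) ℂ := of fun a b =>
    (!![1, N; Nᴴ, Nᴴ * N] : Matrix (Fin 2) (Fin 2) (Matrix (Fin 4) (Fin 4) ℂ)) a.1 b.1 a.2 b.2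
  have hM' : Separable M' := separable_of_normal hN (by simp [M']) (by simp [M']) (by simp [M'])
    (by simp [M'])
  have : M = M'.submatrix (Prod.map id (e ∘ Sum.inl)) (Prod.map id (e ∘ Sum.inl)) := by
    ext ⟨i, j⟩ ⟨k, l⟩
    have hNN : Nᴴ * N = (N₀ᴴ * N₀).submatrix e.symm e.symm := by
      simp only [N, conjTranspose_submatrix, submatrix_mul_equiv]
    fin_cases i <;> fin_cases k
    · simp [M', h00, Matrix.one_apply]
    · simp [M', h01, N, N₀]
    · simp [M', h10, N, N₀]
    · simp [M', h11, hNN, N₀, fromBlocks_conjTranspose, fromBlocks_multiply, Matrix.mul_apply, vecMulVec_apply]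
  rw [this]
  exact separable_submatrix hM' _

theorem separable_of_rank_two {n : ℕ} {M : Matrix (Fin 2 × Fin n) (Fin 2 × Fin n) ℂ}
    (hM : PPT M) (h00 : ∀ j l, M (0, j) (0, l) = (1 : Matrix (Fin n) (Fin n) ℂ) j l)
    (hr : M.rank = n ∨ (pt M).rank = n ∨ n = 3 ∧ M.rank = 4 ∧ (pt M).rank = 4) :
    Separable M := by
  obtain ⟨A, hA⟩ : ∃ A : Matrix (Fin n) (Fin n) ℂ, ∀ j l, M (0, j) (1, l) = A j l :=
    ⟨of fun j l => M (0, j) (1, l), fun _ _ => rfl⟩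
  obtain ⟨D, hD⟩ : ∃ D : Matrix (Fin n) (Fin n) ℂ, ∀ j l, M (1, j) (1, l) = D j l :=
    ⟨of fun j l => M (1, j) (1, l), fun _ _ => rfl⟩
  have hA' : ∀ j l, M (1, j) (0, l) = Aᴴ j l := fun j l => by
    rw [conjTranspose_apply, ← hA]; exact (hM.1.1.apply _ _).symm
  obtain ⟨hp, hr1⟩ := schur_two hM.1 h00 hA hD
  obtain ⟨hq, hr2⟩ := schur_two (M := pt M) hM.2 h00 (A := Aᴴ) (D := D) hA' hD
  rw [conjTranspose_conjTranspose] at hq hr2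
  have htr : (Aᴴ * A).trace = (A * Aᴴ).trace := trace_mul_comm _ _
  have hnormal : M.rank = n ∨ (pt M).rank = n → Aᴴ * A = A * Aᴴ ∧ D = Aᴴ * A := by
    rintro (h | h)
    · have h1 : D - Aᴴ * A = 0 := eq_zero_of_rank_eq_zero (by omega)
      have h2 : D - A * Aᴴ = 0 := by
        rw [← hq.trace_eq_zero_iff, trace_sub, ← htr, ← trace_sub, h1, trace_zero]
      rw [sub_eq_zero] at h1 h2
      exact ⟨h1.symm.trans h2, h1⟩
    · have h2 : D - A * Aᴴ = 0 := eq_zero_of_rank_eq_zero (by omega)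
      have h1 : D - Aᴴ * A = 0 := by
        rw [← hp.trace_eq_zero_iff, trace_sub, htr, ← trace_sub, h2, trace_zero]
      rw [sub_eq_zero] at h1 h2
      exact ⟨h1.symm.trans h2, h1⟩
  by_cases h : M.rank = n ∨ (pt M).rank = n
  · obtain ⟨h1, h2⟩ := hnormal h
    exact separable_of_normal h1.symm h00 hA hA' (fun j l => by rw [hD, h2])
  · obtain ⟨rfl, h3, h4⟩ := (or_assoc.mpr hr).resolve_left h
    obtain ⟨v, hv⟩ := exists_vecMulVec_of_rank_le_one hp (by omega)
    obtain ⟨X, hX⟩ := exists_vecMulVec_of_rank_le_one hq (by omega)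
    rw [sub_eq_iff_eq_add'] at hv hX
    rcases exists_normal_completion (hv.symm.trans hX) with hn | ⟨ω, z, hω, hz⟩
    · let M₀ : Matrix (Fin 2 × Fin 3) (Fin 2 × Fin 3) ℂ := of fun a b =>
        (!![1, A; Aᴴ, Aᴴ * A] : Matrix (Fin 2) (Fin 2) (Matrix (Fin 3) (Fin 3) ℂ)) a.1 b.1 a.2 b.2
      have hM₀ : Separable M₀ := separable_of_normal hn.symm (by simp [M₀]) (by simp [M₀])
        (by simp [M₀]) (by simp [M₀])
      have : M = M₀ + vecMulVec (prodVec ![0, 1] v) (star (prodVec ![0, 1] v)) := by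
        ext ⟨i, j⟩ ⟨k, l⟩
        fin_cases i <;> fin_cases k <;>
          simp [M₀, prodVec, vecMulVec_apply, h00, hA, hA', hD, hv]
      rw [this]
      exact separable_add hM₀ (separable_prodVec _ _)
    · refine separable_of_normal_completion (X := ω • X) (v := v) (z := z) ?_ hz h00 hA hA'
        (fun j l => by rw [hD, hv])
      rw [← hv, hX, add_right_inj]
      ext j l
      simp only [vecMulVec_apply, Pi.smul_apply, Pi.star_apply, smul_eq_mul, RCLike.star_def,
        map_mul]
      linear_combination -(X j * conj (X l)) * hω

theorem PPT.submatrix {n m n' m' : ℕ} {ρ : Matrix (Fin n × Fin m) (Fin n × Fin m) ℂ} (h : PPT ρ)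
    (f : Fin n' → Fin n) (g : Fin m' → Fin m) :
    PPT (ρ.submatrix (Prod.map f g) (Prod.map f g)) :=
  ⟨h.1.submatrix _, h.2.submatrix (Prod.map f g)⟩

/-- A product basis direction in the kernel can be discarded, on the first factor. -/
theorem separable_of_succ_left {n m : ℕ} {σ : Matrix (Fin (n + 1) × Fin m) (Fin (n + 1) × Fin m) ℂ}
    (h0 : ∀ j x, σ (0, j) x = 0 ∧ σ x (0, j) = 0)
    (hs : Separable (σ.submatrix (Prod.map Fin.succ id) (Prod.map Fin.succ id))) :
    Separable σ := by
  obtain ⟨r, φ, ψ, h⟩ := separable_iff.mp hs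
  refine separable_iff.mpr ⟨r, fun t => Fin.cons 0 (φ t), ψ, fun i j k l => ?_⟩
  refine Fin.cases ?_ (fun i => ?_) i
  · simp [h0]
  · refine Fin.cases ?_ (fun k => ?_) k
    · simp [h0]
    · simpa using h i j k l

/-- A product basis direction in the kernel can be discarded, on the second factor. -/
theorem separable_of_succ_right {n m : ℕ}
    {σ : Matrix (Fin n × Fin (m + 1)) (Fin n × Fin (m + 1)) ℂ}
    (h0 : ∀ i x, σ (i, 0) x = 0 ∧ σ x (i, 0) = 0)
    (hs : Separable (σ.submatrix (Prod.map id Fin.succ) (Prod.map id Fin.succ))) :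
    Separable σ := by
  obtain ⟨r, φ, ψ, h⟩ := separable_iff.mp hs
  refine separable_iff.mpr ⟨r, φ, fun t => Fin.cons 0 (ψ t), fun i j k l => ?_⟩
  refine Fin.cases ?_ (fun j => ?_) j
  · simp [h0]
  · refine Fin.cases ?_ (fun l => ?_) l
    · simp [h0]
    · simpa using h i j k l

theorem exists_isUnit_col {n : ℕ} (i₀ : Fin n) {y : Fin n → ℂ} (hy : y ≠ 0) :
    ∃ B : Matrix (Fin n) (Fin n) ℂ, IsUnit B.det ∧ (fun i => B i i₀) = y := by
  obtain ⟨U, c, hU, hc⟩ := exists_unitary_col i₀ hy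
  have hU' : IsUnit U.det := (isUnit_iff_isUnit_det U).mp (IsUnit.of_mul_eq_one_right _ hU)
  have hc0 : c ≠ 0 := by
    rintro rfl
    rw [det_eq_zero_of_column_eq_zero i₀ (by simp [hc])] at hU'
    exact not_isUnit_zero hU'
  refine ⟨c⁻¹ • U, ?_, ?_⟩
  · rw [det_smul]
    exact ((isUnit_iff_ne_zero.mpr (inv_ne_zero hc0)).pow _).mul hU'
  · ext i
    simp [hc, hc0]

/-- The extreme spectral shifts of a non-scalar Hermitian matrix are positive and singular. -/
theorem exists_spectral_shift {ι : Type*} [Fintype ι] [DecidableEq ι] {Z : Matrix ι ι ℂ}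
    (hZ : Z.IsHermitian) (hs : ∀ c : ℂ, Z ≠ c • 1) :
    ∃ μ ν : ℝ, μ < ν ∧ (Z - (μ : ℂ) • 1).PosSemidef ∧ ((ν : ℂ) • 1 - Z).PosSemidef ∧
      (Z - (μ : ℂ) • 1).rank < Fintype.card ι ∧ ((ν : ℂ) • 1 - Z).rank < Fintype.card ι := by
  obtain ⟨U, d, hU, hd⟩ : ∃ (U : Matrix ι ι ℂ) (d : ι → ℝ), U * Uᴴ = 1 ∧
      Z = U * diagonal (fun i => (d i : ℂ)) * Uᴴ :=
    ⟨hZ.eigenvectorUnitary, hZ.eigenvalues, Unitary.mul_star_self_of_mem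
      hZ.eigenvectorUnitary.2, hZ.spectral_theorem⟩
  have hscal : ∀ c : ℂ, c • (1 : Matrix ι ι ℂ) = U * diagonal (fun _ => c) * Uᴴ := by
    intro c
    rw [← smul_one_eq_diagonal, Matrix.mul_smul, Matrix.mul_one, Matrix.smul_mul, hU]
  have hne : Nonempty ι := by
    by_contra h
    rw [not_nonempty_iff] at h
    exact hs 0 (Subsingleton.elim _ _)
  obtain ⟨i, hi⟩ := Finite.exists_min d
  obtain ⟨j, hj⟩ := Finite.exists_max d
  have hrank : ∀ (e : ι → ℂ) (k : ι), e k = 0 → (U * diagonal e * Uᴴ).rank < Fintype.card ι := by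
    intro e k hk
    refine (rank_mul_le_left _ _).trans_lt ((rank_mul_le_right _ _).trans_lt ?_)
    rw [rank_diagonal]
    exact Fintype.card_subtype_lt (x := k) (by simp [hk])
  have h1 : Z - (d i : ℂ) • 1 = U * diagonal (fun k => ((d k - d i : ℝ) : ℂ)) * Uᴴ := by
    rw [hscal, hd, ← sub_mul, ← mul_sub, diagonal_sub]
    simp
  have h2 : (d j : ℂ) • 1 - Z = U * diagonal (fun k => ((d j - d k : ℝ) : ℂ)) * Uᴴ := by
    rw [hscal, hd, ← sub_mul, ← mul_sub, diagonal_sub]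
    simp
  refine ⟨d i, d j, lt_of_le_of_ne (hi j) fun h => hs (d i) ?_, ?_, ?_, ?_, ?_⟩
  · rw [hscal, hd]
    congr 3
    ext k
    exact_mod_cast le_antisymm ((hj k).trans h.ge) (hi k)
  · rw [h1]
    exact (PosSemidef.diagonal fun k => by
      simpa using Complex.zero_le_real.mpr (sub_nonneg.mpr (hi k))).mul_mul_conjTranspose_same U
  · rw [h2]
    exact (PosSemidef.diagonal fun k => by
      simpa using Complex.zero_le_real.mpr (sub_nonneg.mpr (hj k))).mul_mul_conjTranspose_same U
  · rw [h1]
    exact hrank _ i (by simp)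
  · rw [h2]
    exact hrank _ j (by simp)

/-- A kernel of dimension at least two that is closed under the adjoint contains a Hermitian
element which is not a multiple of a given Hermitian element. -/
theorem exists_hermitian_not_smul {r s : ℕ}
    (K : Submodule ℂ (Matrix (Fin r) (Fin r) ℂ × Matrix (Fin s) (Fin s) ℂ))
    (hK : 2 ≤ Module.finrank ℂ K) (hH : ∀ S ∈ K, (S.1ᴴ, S.2ᴴ) ∈ K) :
    ∃ S ∈ K, S.1.IsHermitian ∧ S.2.IsHermitian ∧ ∀ c : ℂ, S ≠ c • 1 := by
  by_contra! hcon
  have hle : K ≤ Submodule.span ℂ {1} := by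
    intro S hS
    obtain ⟨c, hc⟩ := hcon (S + (S.1ᴴ, S.2ᴴ)) (K.add_mem hS (hH S hS))
      (by simp [IsHermitian, add_comm]) (by simp [IsHermitian, add_comm])
    obtain ⟨d, hd⟩ := hcon (Complex.I • (S - (S.1ᴴ, S.2ᴴ)))
      (K.smul_mem _ (K.sub_mem hS (hH S hS)))
      (by simp [IsHermitian, conjTranspose_smul, smul_sub]; abel)
      (by simp [IsHermitian, conjTranspose_smul, smul_sub]; abel)
    refine Submodule.mem_span_singleton.mpr ⟨(c - Complex.I * d) / 2, ?_⟩
    have : S = (1 / 2 : ℂ) • ((S + (S.1ᴴ, S.2ᴴ)) - Complex.I • (Complex.I • (S - (S.1ᴴ, S.2ᴴ)))) := by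
      rw [smul_smul, Complex.I_mul_I]
      module
    rw [this, hc, hd]
    module
  have := (Submodule.finrank_mono hle).trans (finrank_span_le_card _)
  simp only [Set.toFinset_singleton, Finset.card_singleton] at this
  omega

/-- A state with large ranks splits into states with smaller ranks. -/
theorem PPT.exists_split {n m : ℕ} {ρ : Matrix (Fin n × Fin m) (Fin n × Fin m) ℂ} (hρ : PPT ρ)
    (h : (n * m) ^ 2 + 1 < ρ.rank ^ 2 + (_root_.pt ρ).rank ^ 2) :
    ∃ (c : ℝ) (σ τ : Matrix (Fin n × Fin m) (Fin n × Fin m) ℂ), 0 < c ∧ PPT σ ∧ PPT τ ∧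
      (c : ℂ) • ρ = σ + τ ∧ σ.rank + (_root_.pt σ).rank < ρ.rank + (_root_.pt ρ).rank ∧
      τ.rank + (_root_.pt τ).rank < ρ.rank + (_root_.pt ρ).rank := by
  obtain ⟨C, hC⟩ := exists_factorization hρ.1
  obtain ⟨C', hC'⟩ := exists_factorization hρ.2
  generalize ρ.rank = r at *
  generalize (_root_.pt ρ).rank = s at *
  let Φ : Matrix (Fin r) (Fin r) ℂ × Matrix (Fin s) (Fin s) ℂ →ₗ[ℂ]
      Matrix (Fin n × Fin m) (Fin n × Fin m) ℂ :=
    { toFun := fun S => _root_.pt (Cᴴ * S.1 * C) - C'ᴴ * S.2 * C'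
      map_add' := by
        intro S T
        have : ∀ P Q : Matrix (Fin n × Fin m) (Fin n × Fin m) ℂ,
          _root_.pt (P + Q) = _root_.pt P + _root_.pt Q := fun _ _ => rfl
        simp only [Prod.fst_add, Prod.snd_add, Matrix.mul_add, Matrix.add_mul, this]
        abel
      map_smul' := by
        intro c S
        have : ∀ P : Matrix (Fin n × Fin m) (Fin n × Fin m) ℂ,
          _root_.pt (c • P) = c • _root_.pt P := fun _ => rfl
        simp [this, smul_sub] }
  have hΦ : ∀ S, S ∈ LinearMap.ker Φ ↔ _root_.pt (Cᴴ * S.1 * C) = C'ᴴ * S.2 * C' := by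
    intro S
    exact LinearMap.mem_ker.trans sub_eq_zero
  have hptH : ∀ P : Matrix (Fin n × Fin m) (Fin n × Fin m) ℂ, (_root_.pt P)ᴴ = _root_.pt Pᴴ :=
    fun _ => rfl
  have hK : 2 ≤ Module.finrank ℂ (LinearMap.ker Φ) := by
    have h1 := LinearMap.finrank_range_add_finrank_ker Φ
    have h2 := Submodule.finrank_le (LinearMap.range Φ)
    simp only [Module.finrank_prod, Module.finrank_matrix, Fintype.card_fin, Fintype.card_prod,
      Module.finrank_self, mul_one] at h1 h2
    simp only [pow_two] at h
    omega
  obtain ⟨S, hS, hS1, hS2, hSc⟩ := exists_hermitian_not_smul _ hK (fun S hS => by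
    rw [hΦ] at hS ⊢
    have := congrArg conjTranspose hS
    rw [hptH] at this
    simpa [Matrix.mul_assoc] using this)
  rw [hΦ] at hS
  have h11 : _root_.pt (Cᴴ * (1 : Matrix (Fin r) (Fin r) ℂ) * C) =
      C'ᴴ * (1 : Matrix (Fin s) (Fin s) ℂ) * C' := by
    rw [Matrix.mul_one, Matrix.mul_one, ← hC, hC']
  obtain ⟨μ, ν, hμν, hp, hq, hpr, hqr⟩ := exists_spectral_shift (Z := fromBlocks S.1 0 0 S.2)
    (IsHermitian.fromBlocks hS1 (by simp) hS2) (fun c hc => hSc c (by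
      rw [← fromBlocks_one, fromBlocks_smul, fromBlocks_inj] at hc
      exact Prod.ext hc.1 hc.2.2.2))
  have hfs : ∀ (P P' : Matrix (Fin r) (Fin r) ℂ) (Q Q' : Matrix (Fin s) (Fin s) ℂ),
      fromBlocks P 0 0 Q - fromBlocks P' 0 0 Q' = fromBlocks (P - P') 0 0 (Q - Q') := by
    intro P P' Q Q'
    ext (i | i) (j | j) <;> simp
  rw [← fromBlocks_one, fromBlocks_smul, smul_zero, smul_zero, hfs] at hp hq hpr hqr
  simp only [rank_fromBlocks_diag, Fintype.card_sum, Fintype.card_fin] at hpr hqr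
  have hmk : ∀ T : Matrix (Fin r) (Fin r) ℂ × Matrix (Fin s) (Fin s) ℂ,
      _root_.pt (Cᴴ * T.1 * C) = C'ᴴ * T.2 * C' →
      (fromBlocks T.1 0 0 T.2).PosSemidef → T.1.rank + T.2.rank < r + s →
      PPT (Cᴴ * T.1 * C) ∧
        (Cᴴ * T.1 * C).rank + (_root_.pt (Cᴴ * T.1 * C)).rank < r + s := by
    intro T hT hP hr
    refine ⟨⟨?_, ?_⟩, ?_⟩
    · exact PosSemidef.conjTranspose_mul_mul_same (hP.submatrix Sum.inl) C
    · rw [hT]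
      exact PosSemidef.conjTranspose_mul_mul_same (hP.submatrix Sum.inr) C'
    · rw [hT]
      have h1 := (rank_mul_le_left (Cᴴ * T.1) C).trans (rank_mul_le_right Cᴴ T.1)
      have h2 := (rank_mul_le_left (C'ᴴ * T.2) C').trans (rank_mul_le_right C'ᴴ T.2)
      omega
  have hsub : ∀ P Q : Matrix (Fin n × Fin m) (Fin n × Fin m) ℂ,
    _root_.pt (P - Q) = _root_.pt P - _root_.pt Q := fun _ _ => rfl
  have hsmul : ∀ (c : ℂ) (P : Matrix (Fin n × Fin m) (Fin n × Fin m) ℂ),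
    _root_.pt (c • P) = c • _root_.pt P := fun _ _ => rfl
  obtain ⟨hσ, hσr⟩ := hmk (S.1 - (μ : ℂ) • 1, S.2 - (μ : ℂ) • 1)
    (by simp only [Matrix.mul_sub, Matrix.sub_mul, Matrix.mul_smul, Matrix.smul_mul, hsub, hsmul, hS, h11])
    hp hpr
  obtain ⟨hτ, hτr⟩ := hmk ((ν : ℂ) • 1 - S.1, (ν : ℂ) • 1 - S.2)
    (by simp only [Matrix.mul_sub, Matrix.sub_mul, Matrix.mul_smul, Matrix.smul_mul, hsub, hsmul, hS, h11])
    hq hqr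
  refine ⟨ν - μ, _, _, sub_pos.mpr hμν, hσ, hτ, ?_, hσr, hτr⟩
  simp only [Matrix.mul_sub, Matrix.sub_mul, Matrix.mul_smul, Matrix.smul_mul, Matrix.mul_one, hC]
  push_cast
  module

theorem mulVec_prodVec_eq_zero {n m : ℕ} {ρ : Matrix (Fin n × Fin m) (Fin n × Fin m) ℂ}
    (h : ρ.PosSemidef) {a : Fin n → ℂ} {x : Fin m → ℂ} (hx : blk ρ a a *ᵥ x = 0) :
    ρ *ᵥ prodVec a x = 0 := by
  rw [← h.dotProduct_mulVec_zero_iff]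
  have : star (prodVec a x) ⬝ᵥ ρ *ᵥ prodVec a x = ∑ j, conj (x j) * (blk ρ a a *ᵥ x) j := by
    simp only [mulVec_prodVec, dotProduct, Fintype.sum_prod_type, Finset.mul_sum, prodVec,
      Pi.star_apply, RCLike.star_def, map_mul]
    rw [Finset.sum_comm]
    exact Finset.sum_congr rfl fun _ _ => Finset.sum_congr rfl fun _ _ => by ring
  rw [this, hx]
  simp

theorem loc_apply_eq_zero {n m n' m' : ℕ} {ρ : Matrix (Fin n × Fin m) (Fin n × Fin m) ℂ}
    (h : ρ.IsHermitian) {A : Matrix (Fin n) (Fin n') ℂ} {B : Matrix (Fin m) (Fin m') ℂ}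
    {k : Fin n'} {l : Fin m'} (h0 : ρ *ᵥ prodVec (fun i => A i k) (fun j => B j l) = 0)
    (x : Fin n' × Fin m') : loc A B ρ (k, l) x = 0 ∧ loc A B ρ x (k, l) = 0 := by
  have h1 : loc A B ρ x (k, l) = 0 := by
    rw [loc, Matrix.mul_assoc, Matrix.mul_apply]
    refine Finset.sum_eq_zero fun y _ => ?_
    have : (ρ * kroneckerMap (· * ·) A B) y (k, l) = 0 := congrFun h0 y
    rw [this, mul_zero]
  refine ⟨?_, h1⟩
  have : (loc A B ρ).IsHermitian := isHermitian_conjTranspose_mul_mul _ h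
  rw [← this.apply, h1, star_zero]

theorem exists_normalizing_of_injective {n : ℕ} {P : Matrix (Fin n) (Fin n) ℂ}
    (hP : P.PosSemidef) (h : ∀ x, P *ᵥ x = 0 → x = 0) :
    ∃ B : Matrix (Fin n) (Fin n) ℂ, IsUnit B.det ∧ Bᴴ * P * B = 1 := by
  have hu : IsUnit P := mulVec_injective_iff_isUnit.mp
    ((injective_iff_map_eq_zero (Matrix.mulVecLin P)).mpr h)
  obtain ⟨C, hC⟩ : ∃ C : Matrix (Fin n) (Fin n) ℂ, P = Cᴴ * C := by
    have := exists_factorization hP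
    rwa [rank_of_isUnit _ hu, Fintype.card_fin] at this
  have hCu : IsUnit C.det := by
    rw [isUnit_iff_isUnit_det, hC, det_mul] at hu
    exact isUnit_of_mul_isUnit_right hu
  refine ⟨C⁻¹, isUnit_nonsing_inv_det _ hCu, ?_⟩
  rw [hC, ← Matrix.mul_assoc, ← conjTranspose_mul, mul_nonsing_inv _ hCu, Matrix.mul_assoc,
    mul_nonsing_inv _ hCu]
  simp

/-- Some diagonal compression of a state with full local support is nonsingular. -/
theorem exists_blk_injective {n : ℕ} {ρ : Matrix (Fin 2 × Fin n) (Fin 2 × Fin n) ℂ} (hρ : PPT ρ)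
    (hG : ∀ f, (∀ i, ρ *ᵥ prodVec (Pi.single i 1) f = 0) → f = 0) :
    ∃ a : Fin 2 → ℂ, a ≠ 0 ∧ ∀ x, blk ρ a a *ᵥ x = 0 → x = 0 := by
  by_contra! hcon
  let a : ℕ → Fin 2 → ℂ := fun t => ![1, t]
  have ha : ∀ t, a t ≠ 0 := fun t h => one_ne_zero (congrFun h 0)
  have hconj : ∀ t, (fun i => conj (a t i)) = a t := by
    intro t
    ext i
    fin_cases i <;> simp [a]
  choose x hx hx0 using fun t => hcon (a t) (ha t)
  let B : Fin 2 → Fin 2 → Matrix (Fin n) (Fin n) ℂ := fun i k => of fun j l => ρ (i, j) (k, l)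
  have hBH : ∀ i k, (B i k)ᴴ = B k i := by
    intro i k
    ext j l
    exact hρ.1.1.apply (k, j) (i, l)
  have hB : ∀ i k y z, star y ⬝ᵥ B i k *ᵥ z = star (B k i *ᵥ y) ⬝ᵥ z := by
    intro i k y z
    rw [dotProduct_mulVec, star_mulVec, hBH]
  have h1 : ∀ t i, B i 0 *ᵥ x t + (t : ℂ) • B i 1 *ᵥ x t = 0 := by
    intro t i
    have := mulVec_prodVec_eq_zero hρ.1 (hx t)
    ext j
    refine Eq.trans ?_ (congrFun this (i, j))
    simp [mulVec, dotProduct, Fintype.sum_prod_type, B, prodVec, a, Finset.mul_sum]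
    exact Finset.sum_congr rfl fun _ _ => by ring
  have h2 : ∀ t i, B 0 i *ᵥ x t + (t : ℂ) • B 1 i *ᵥ x t = 0 := by
    intro t i
    have := mulVec_prodVec_eq_zero hρ.2 (a := a t) (x := x t) (by
      rw [blk_pt, hconj]; exact hx t)
    ext j
    refine Eq.trans ?_ (congrFun this (i, j))
    simp [mulVec, dotProduct, Fintype.sum_prod_type, B, prodVec, a, Finset.mul_sum, pt]
    exact Finset.sum_congr rfl fun _ _ => by ring
  have horth : ∀ s t, s ≠ t → ∀ i, star (x s) ⬝ᵥ B i i *ᵥ x t = 0 := by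
    intro s t hst i
    have e1 := congrArg (star (x s) ⬝ᵥ ·) (h1 t i)
    have e2 := congrArg (fun y => star y ⬝ᵥ x t) (h2 s i)
    simp only [dotProduct_add, dotProduct_smul, dotProduct_zero, star_add, star_smul,
      add_dotProduct, smul_dotProduct, star_zero, zero_dotProduct, ← hB, smul_eq_mul, star_natCast] at e1 e2
    have hst' : (s : ℂ) - t ≠ 0 := sub_ne_zero.mpr (by exact_mod_cast hst)
    have e3 : star (x s) ⬝ᵥ B i 1 *ᵥ x t = 0 :=
      (mul_eq_zero.mp (by linear_combination e2 - e1)).resolve_left hst'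
    have e0 : star (x s) ⬝ᵥ B i 0 *ᵥ x t = 0 := by
      rw [e3, mul_zero, add_zero] at e1
      exact e1
    fin_cases i
    · exact e0
    · exact e3
  have hli : LinearIndependent ℂ fun t : Fin (n + 1) => x t := by
    rw [Fintype.linearIndependent_iff]
    intro g hg s
    by_contra hgs
    refine hx0 s (hG _ fun i => ?_)
    have e : g s * (star (x s) ⬝ᵥ B i i *ᵥ x s) = 0 := by
      have := congrArg (fun y => star (x s) ⬝ᵥ B i i *ᵥ y) hg
      simp only [mulVec_sum, dotProduct_sum, mulVec_smul, dotProduct_smul, mulVec_zero,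
        dotProduct_zero, smul_eq_mul] at this
      rwa [Finset.sum_eq_single s (fun t _ hts => by
        rw [horth s t (fun h => hts (Fin.ext h.symm)), mul_zero]) (by simp)] at this
    have hBi : (B i i).PosSemidef := hρ.1.submatrix fun j => (i, j)
    have e' := (hBi.dotProduct_mulVec_zero_iff _).mp ((mul_eq_zero.mp e).resolve_left hgs)
    refine mulVec_prodVec_eq_zero hρ.1 ?_
    have : blk ρ (Pi.single i 1) (Pi.single i 1) = B i i := by
      ext j l
      simp [blk, B, Pi.single_apply]
    rw [this, e']
  have := hli.fintype_card_le_finrank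
  simp at this

theorem separable_of_smul {n m : ℕ} {ρ : Matrix (Fin n × Fin m) (Fin n × Fin m) ℂ} {c : ℝ}
    (hc : 0 < c) (h : Separable ((c : ℂ) • ρ)) : Separable ρ := by
  have := separable_smul h (inv_nonneg.mpr hc.le)
  rwa [smul_smul, ← Complex.ofReal_mul, inv_mul_cancel₀ hc.ne', Complex.ofReal_one, one_smul]
    at this

theorem rank_cases_of_sq_le {n r s : ℕ} (hn : n ≤ 3) (hr : n ≤ r) (hs : n ≤ s)
    (h : r ^ 2 + s ^ 2 ≤ (2 * n) ^ 2 + 1) : r = n ∨ s = n ∨ n = 3 ∧ r = 4 ∧ s = 4 := by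
  by_contra! hcon
  obtain ⟨h1, h2, h3⟩ := hcon
  have hr' : n + 1 ≤ r := by omega
  have hs' : n + 1 ≤ s := by omega
  have hn3 : n = 3 := by
    by_contra hn'
    have : n ≤ 2 := by omega
    nlinarith
  subst hn3
  have hr4 : r ≤ 4 := by nlinarith
  have hs4 : s ≤ 4 := by nlinarith
  exact h3 rfl (by omega) (by omega)

theorem le_rank_of_block_one {n : ℕ} {M : Matrix (Fin 2 × Fin n) (Fin 2 × Fin n) ℂ}
    (hM : M.PosSemidef) (h00 : ∀ j l, M (0, j) (0, l) = (1 : Matrix (Fin n) (Fin n) ℂ) j l) :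
    n ≤ M.rank := by
  rw [(schur_two hM h00 (A := of fun j l => M (0, j) (1, l)) (D := of fun j l => M (1, j) (1, l))
    (fun _ _ => rfl) (fun _ _ => rfl)).2]
  exact Nat.le_add_right _ _

/-- Positive partial transpose implies separability in dimensions `2 × N` with `N ≤ 3`. -/
theorem PPT.separable_two : ∀ (N : ℕ), N ≤ 3 →
    ∀ ρ : Matrix (Fin 2 × Fin N) (Fin 2 × Fin N) ℂ, PPT ρ → Separable ρ := by
  intro N
  induction N with
  | zero =>
    intro _ ρ _
    rw [Subsingleton.elim ρ 0]
    exact separable_zero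
  | succ n ih =>
    intro hN ρ
    generalize hk : ρ.rank + (_root_.pt ρ).rank = k
    induction k using Nat.strong_induction_on generalizing ρ with
    | h k ihk =>
    intro hρ
    by_cases hG : ∀ f, (∀ i, ρ *ᵥ prodVec (Pi.single i 1) f = 0) → f = 0
    · by_cases hr : (2 * (n + 1)) ^ 2 + 1 < ρ.rank ^ 2 + (_root_.pt ρ).rank ^ 2
      · obtain ⟨c, σ, τ, hc, hσ, hτ, h, hσr, hτr⟩ := hρ.exists_split hr
        refine separable_of_smul hc ?_
        rw [h]
        exact separable_add (ihk _ (hk ▸ hσr) σ rfl hσ) (ihk _ (hk ▸ hτr) τ rfl hτ)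
      · obtain ⟨a, ha, hinj⟩ := exists_blk_injective hρ hG
        obtain ⟨A, hA, rfl⟩ := exists_isUnit_col 0 ha
        obtain ⟨B, hB, hB1⟩ := exists_normalizing_of_injective (blk_posSemidef hρ.1 _) hinj
        refine separable_of_loc hA hB ?_
        rw [← rank_loc hA hB ρ, ← rank_pt_loc hA hB ρ] at hr
        have hM := hρ.loc A B
        have h00 : ∀ j l, PPTRank.loc A B ρ (0, j) (0, l) =
            (1 : Matrix (Fin (n + 1)) (Fin (n + 1)) ℂ) j l := by
          intro j l
          rw [loc_eq_blk, hB1]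
        refine separable_of_rank_two hM h00 ?_
        have h1 := le_rank_of_block_one hM.1 h00
        have h2 := le_rank_of_block_one hM.2 h00
        exact rank_cases_of_sq_le (by omega) h1 h2 (not_lt.mp hr)
    · push Not at hG
      obtain ⟨f, hf, hf0⟩ := hG
      obtain ⟨B, hB, rfl⟩ := exists_isUnit_col 0 hf0
      have h1 : IsUnit (1 : Matrix (Fin 2) (Fin 2) ℂ).det := by simp
      refine separable_of_loc h1 hB (separable_of_succ_right (fun i x => ?_) ?_)
      · refine loc_apply_eq_zero hρ.1.1 ?_ x
        convert hf i using 2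
        congr 1
        ext k
        simp [Matrix.one_apply, Pi.single_apply]
      · exact ih (by omega) _ ((hρ.loc 1 B).submatrix id Fin.succ)

theorem separable_of_rows_left {ρ : Matrix (Fin 3 × Fin 3) (Fin 3 × Fin 3) ℂ} (hρ : PPT ρ)
    (h0 : ∀ j, ρ (0, j) (0, j) = 0) : Separable ρ :=
  separable_of_succ_left (fun j => apply_eq_zero_of_diag_eq_zero hρ.1 (h0 j))
    (PPT.separable_two 3 le_rfl _ (hρ.submatrix Fin.succ id))

theorem posSemidef_sub_vecMulVec {ι : Type*} [Fintype ι] [DecidableEq ι] {M : Matrix ι ι ℂ}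
    (hM : M.PosSemidef) {o : ι} (h1 : M o o = 1) :
    (M - vecMulVec (fun x => M x o) (star fun x => M x o)).PosSemidef := by
  have h := hM.conjTranspose_mul_mul_same (1 - vecMulVec (Pi.single o 1) (fun x => M o x))
  have e : M * (1 - vecMulVec (Pi.single o 1) (fun x => M o x)) =
      of fun x y => M x y - M x o * M o y := by
    ext x y
    simp [Matrix.mul_sub, mul_vecMulVec, vecMulVec_apply]
  convert h using 1
  rw [Matrix.mul_assoc, e]
  ext x y
  simp [Matrix.sub_mul, conjTranspose_vecMulVec, vecMulVec_mul, vecMulVec_apply, h1, ← hM.1.apply y o]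

theorem separable_of_block_single {σ : Matrix (Fin 3 × Fin 3) (Fin 3 × Fin 3) ℂ} (hσ : PPT σ)
    (h : ∀ j l, σ (0, j) (0, l) = if j = 0 ∧ l = 0 then 1 else 0) : Separable σ := by
  have hr : ∀ α, α ≠ 0 → ∀ x, σ (0, α) x = 0 ∧ σ x (0, α) = 0 := fun α hα =>
    apply_eq_zero_of_diag_eq_zero hσ.1 (by rw [h, if_neg (by simp [hα])])
  have hr' : ∀ α, α ≠ 0 → ∀ x, pt σ (0, α) x = 0 ∧ pt σ x (0, α) = 0 := fun α hα =>
    apply_eq_zero_of_diag_eq_zero hσ.2 (by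
      refine Eq.trans ?_ ((h α α).trans (if_neg (by simp [hα])))
      rfl)
  have hz : ∀ i α, α ≠ 0 → σ (i, α) (0, 0) = 0 := fun i α hα => (hr' α hα (i, 0)).1
  set z : Fin 3 × Fin 3 → ℂ := fun x => σ x (0, 0)
  have hzp : z = prodVec (fun i => σ (i, 0) (0, 0)) (Pi.single 0 1) := by
    ext ⟨i, α⟩
    by_cases hα : α = 0
    · simp [z, prodVec, hα]
    · simp [z, prodVec, hα, hz]
  have h1 : (σ - vecMulVec z (star z)).PosSemidef :=
    posSemidef_sub_vecMulVec hσ.1 (by simp [h])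
  have h2 : (pt (σ - vecMulVec z (star z))).PosSemidef := by
    have h00 : pt σ (0, 0) (0, 0) = 1 := (h 0 0).trans (by simp)
    convert posSemidef_sub_vecMulVec hσ.2 h00 using 1
    ext ⟨i, α⟩ ⟨k, β⟩
    simp only [pt, Matrix.sub_apply, of_apply, vecMulVec_apply, Pi.star_apply, z]
    by_cases hα : α = 0
    · by_cases hβ : β = 0
      · subst hα hβ
        rw [← hσ.1.1.apply (0, 0) (i, 0), hσ.1.1.apply (k, 0) (0, 0)]
        ring
      · rw [hz i β hβ, (hr β hβ _).1]
        simp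
    · rw [hz k α hα, (hr α hα _).1]
      simp
  have hs : Separable (σ - vecMulVec z (star z)) := by
    refine separable_of_rows_left ⟨h1, h2⟩ fun j => ?_
    by_cases hj : j = 0 <;> simp [z, vecMulVec_apply, h, hj]
  have := separable_add hs (hzp ▸ separable_prodVec _ _)
  rwa [sub_add_cancel] at this

/-- A degenerate compression of a PPT matrix on `ℂ³ ⊗ ℂ³` forces separability. -/
theorem separable_of_blk_rank_le_one {ρ : Matrix (Fin 3 × Fin 3) (Fin 3 × Fin 3) ℂ}
    (hρ : PPT ρ) {a : Fin 3 → ℂ} (ha : a ≠ 0) (hr : (blk ρ a a).rank ≤ 1) : Separable ρ := by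
  obtain ⟨A, hA, rfl⟩ := exists_isUnit_col 0 ha
  obtain ⟨u, hu⟩ := exists_vecMulVec_of_rank_le_one (blk_posSemidef hρ.1 _) hr
  by_cases hu0 : u = 0
  · refine separable_of_loc (B := 1) hA (by simp) (separable_of_rows_left (hρ.loc A 1) fun j => ?_)
    rw [loc_eq_blk, hu, hu0]
    simp
  · obtain ⟨B, hB, rfl⟩ := exists_isUnit_col 0 hu0
    have hBi : IsUnit ((B⁻¹)ᴴ).det := by
      rw [det_conjTranspose]
      exact (isUnit_nonsing_inv_det B hB).star
    refine separable_of_loc hA hBi (separable_of_block_single (hρ.loc A _) fun j l => ?_)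
    have hcol : B⁻¹ *ᵥ (fun i => B i 0) = Pi.single 0 1 := by
      ext i
      have := congrFun (congrFun (nonsing_inv_mul B hB) i) 0
      rw [Matrix.mul_apply] at this
      simpa [mulVec, dotProduct, Pi.single_apply, Matrix.one_apply] using this
    have e : (B⁻¹)ᴴᴴ * vecMulVec (fun i => B i 0) (star fun i => B i 0) * (B⁻¹)ᴴ =
        vecMulVec (Pi.single 0 1) (star (Pi.single 0 1)) := by
      rw [conjTranspose_conjTranspose, mul_vecMulVec, vecMulVec_mul, hcol, ← star_mulVec, hcol]
    rw [loc_eq_blk, hu, e]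
    by_cases hj : j = 0 <;> by_cases hl : l = 0 <;> simp [vecMulVec_apply, hj, hl]

theorem blk_rank_le_two {ρ : Matrix (Fin 3 × Fin 3) (Fin 3 × Fin 3) ℂ} {a b : Fin 3 → ℂ}
    (hb : b ≠ 0) (h : ρ *ᵥ prodVec a b = 0) : (blk ρ a a).rank ≤ 2 := by
  have h0 : blk ρ a a *ᵥ b = 0 := by
    ext j
    simp [mulVec_prodVec, h]
  have hker : 0 < Module.finrank ℂ (LinearMap.ker (blk ρ a a).mulVecLin) :=
    Module.finrank_pos_iff_exists_ne_zero.mpr ⟨⟨b, h0⟩, fun h => hb (congrArg Subtype.val h)⟩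
  have := (blk ρ a a).mulVecLin.finrank_range_add_finrank_ker
  rw [Module.finrank_fin_fun] at this
  rw [Matrix.rank]
  omega

end PPTRank

theorem stmt9 (ρ : Matrix (Fin 3 × Fin 3) (Fin 3 × Fin 3) ℂ)
    (hne : ρ ≠ 0) (hpsd : ρ.PosSemidef) (hppt : (pt ρ).PosSemidef)
    (hrank : ρ.rank = 4) (hsep : ¬ Separable ρ) :
    (pt ρ).rank = 4 := by
  have hρ : PPTRank.PPT ρ := ⟨hpsd, hppt⟩
  obtain ⟨a, b, ha, hb, h0⟩ := PPTRank.exists_prodVec_mem_ker hpsd hrank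
  refine PPTRank.rank_pt_of_blk_rank hρ hrank ha hb h0 ?_ ?_
  · refine le_antisymm (PPTRank.blk_rank_le_two hb h0) (not_lt.mp fun h => hsep ?_)
    exact PPTRank.separable_of_blk_rank_le_one hρ ha (Nat.le_of_lt_succ h)
  · refine le_antisymm (PPTRank.blk_rank_le_two ha (PPTRank.swap_mulVec ρ a b h0))
      (not_lt.mp fun h => hsep ?_)
    exact PPTRank.separable_of_swap
      (PPTRank.separable_of_blk_rank_le_one hρ.swap hb (Nat.le_of_lt_succ h))
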